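/- arXiv:2107.05912 — 6 statements merged into one kernel-verified Lean document; each statement's English description precedes it below -/
import Mathlib

section
/- Epimorphism-surjectivity for varieties of Gödel algebras: let K be a variety of Heyting algebras every member of which satisfies the prelinearity identity (x ⇨ y) ⊔ (y ⇨ x) = ⊤ (i.e., K consists of Gödel algebras). Then every K-epimorphism h : A → B with A, B ∈ K is surjective. -/
/-!
STATEMENT 13: Epimorphism-surjectivity for varieties of Gödel algebras: if every
member of a variety `K` of Heyting algebras satisfies the prelinearity identity
`(x ⇨ y) ⊔ (y ⇨ x) = ⊤`, then every `K`-epimorphism between members of `K` is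
surjective.
-/

universe u

open Order

namespace Order.PFilter

section Heyting

variable {α β : Type*} [HeytingAlgebra α] [HeytingAlgebra β]

theorem himp_trans (F : PFilter α) {x y z : α} (hxy : x ⇨ y ∈ F) (hyz : y ⇨ z ∈ F) :
    x ⇨ z ∈ F :=
  mem_of_le (himp_triangle x y z) (inf_mem hxy hyz)

theorem himp_mem_of_le (F : PFilter α) {x y : α} (hxy : x ≤ y) : x ⇨ y ∈ F := by
  rw [himp_eq_top_iff.2 hxy]
  exact top_mem

theorem mem_of_himp_mem {F : PFilter α} {x y : α} (hxy : x ⇨ y ∈ F) (hx : x ∈ F) : y ∈ F :=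
  mem_of_le himp_inf_le (inf_mem hxy hx)

/-- The congruence of a Heyting algebra determined by a filter. -/
def heytingSetoid (F : PFilter α) : Setoid α where
  r x y := x ⇨ y ∈ F ∧ y ⇨ x ∈ F
  iseqv :=
    { refl _ := ⟨F.himp_mem_of_le le_rfl, F.himp_mem_of_le le_rfl⟩
      symm h := ⟨h.2, h.1⟩
      trans h k := ⟨F.himp_trans h.1 k.1, F.himp_trans k.2 h.2⟩ }

/-- The quotient of a Heyting algebra by a filter. -/
def HeytingQuotient (F : PFilter α) : Type _ := Quotient F.heytingSetoid

theorem sup_himp_sup_mem (F : PFilter α) {x x' y y' : α} (hx : x ⇨ x' ∈ F) (hy : y ⇨ y' ∈ F) :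
    x ⊔ y ⇨ x' ⊔ y' ∈ F := by
  rw [sup_himp_distrib]
  exact inf_mem (F.himp_trans hx (F.himp_mem_of_le le_sup_left))
    (F.himp_trans hy (F.himp_mem_of_le le_sup_right))

theorem inf_himp_inf_mem (F : PFilter α) {x x' y y' : α} (hx : x ⇨ x' ∈ F) (hy : y ⇨ y' ∈ F) :
    x ⊓ y ⇨ x' ⊓ y' ∈ F := by
  rw [himp_inf_distrib]
  exact inf_mem (F.himp_trans (F.himp_mem_of_le inf_le_left) hx)
    (F.himp_trans (F.himp_mem_of_le inf_le_right) hy)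

theorem himp_himp_himp_mem (F : PFilter α) {x x' y y' : α} (hx : x' ⇨ x ∈ F) (hy : y ⇨ y' ∈ F) :
    (x ⇨ y) ⇨ (x' ⇨ y') ∈ F := by
  rw [himp_himp]
  exact F.himp_trans (F.inf_himp_inf_mem (F.himp_mem_of_le le_rfl) hx)
    (F.himp_trans (F.himp_mem_of_le himp_inf_le) hy)

instance (F : PFilter α) : HeytingAlgebra F.HeytingQuotient where
  le := Quotient.lift₂ (fun x y => x ⇨ y ∈ F) fun _ _ _ _ h k => propext
    ⟨fun l => F.himp_trans h.2 (F.himp_trans l k.1),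
      fun l => F.himp_trans h.1 (F.himp_trans l k.2)⟩
  le_refl := by
    rintro ⟨x⟩
    exact F.himp_mem_of_le le_rfl
  le_trans := by
    rintro ⟨x⟩ ⟨y⟩ ⟨z⟩ h k
    exact F.himp_trans h k
  le_antisymm := by
    rintro ⟨x⟩ ⟨y⟩ h k
    exact Quotient.sound ⟨h, k⟩
  sup := Quotient.map₂ (· ⊔ ·) fun _ _ h _ _ k =>
    ⟨F.sup_himp_sup_mem h.1 k.1, F.sup_himp_sup_mem h.2 k.2⟩
  le_sup_left := by
    rintro ⟨x⟩ ⟨y⟩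
    exact F.himp_mem_of_le le_sup_left
  le_sup_right := by
    rintro ⟨x⟩ ⟨y⟩
    exact F.himp_mem_of_le le_sup_right
  sup_le := by
    rintro ⟨x⟩ ⟨y⟩ ⟨z⟩ h k
    change x ⊔ y ⇨ z ∈ F
    rw [sup_himp_distrib]
    exact inf_mem h k
  inf := Quotient.map₂ (· ⊓ ·) fun _ _ h _ _ k =>
    ⟨F.inf_himp_inf_mem h.1 k.1, F.inf_himp_inf_mem h.2 k.2⟩
  inf_le_left := by
    rintro ⟨x⟩ ⟨y⟩
    exact F.himp_mem_of_le inf_le_left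
  inf_le_right := by
    rintro ⟨x⟩ ⟨y⟩
    exact F.himp_mem_of_le inf_le_right
  le_inf := by
    rintro ⟨x⟩ ⟨y⟩ ⟨z⟩ h k
    change x ⇨ y ⊓ z ∈ F
    rw [himp_inf_distrib]
    exact inf_mem h k
  top := Quotient.mk _ ⊤
  le_top := by
    rintro ⟨x⟩
    exact F.himp_mem_of_le le_top
  bot := Quotient.mk _ ⊥
  bot_le := by
    rintro ⟨x⟩
    exact F.himp_mem_of_le bot_le
  himp := Quotient.map₂ (· ⇨ ·) fun _ _ h _ _ k =>
    ⟨F.himp_himp_himp_mem h.2 k.1, F.himp_himp_himp_mem h.1 k.2⟩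
  le_himp_iff := by
    rintro ⟨x⟩ ⟨y⟩ ⟨z⟩
    change x ⇨ y ⇨ z ∈ F ↔ x ⊓ y ⇨ z ∈ F
    rw [himp_himp]
  compl := Quotient.map (·ᶜ) fun x y h => by
    simp only [← himp_bot]
    exact ⟨F.himp_himp_himp_mem h.2 (F.himp_mem_of_le le_rfl),
      F.himp_himp_himp_mem h.1 (F.himp_mem_of_le le_rfl)⟩
  himp_bot := by
    rintro ⟨x⟩
    exact congrArg (Quotient.mk _) (himp_bot x)

/-- The quotient map of a Heyting algebra by a filter. -/
def toHeytingQuotient (F : PFilter α) : HeytingHom α F.HeytingQuotient where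
  toFun := Quotient.mk _
  map_sup' _ _ := rfl
  map_inf' _ _ := rfl
  map_bot' := rfl
  map_himp' _ _ := rfl

theorem toHeytingQuotient_surjective (F : PFilter α) : Function.Surjective F.toHeytingQuotient :=
  Quotient.mk_surjective

theorem toHeytingQuotient_le_iff {F : PFilter α} {x y : α} :
    F.toHeytingQuotient x ≤ F.toHeytingQuotient y ↔ x ⇨ y ∈ F :=
  Iff.rfl

theorem toHeytingQuotient_eq_top_iff {F : PFilter α} {x : α} :
    F.toHeytingQuotient x = ⊤ ↔ x ∈ F := by
  rw [← top_le_iff, ← map_top F.toHeytingQuotient, toHeytingQuotient_le_iff, top_himp]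

/-- The preimage of a filter under a Heyting homomorphism. -/
def heytingComap (f : HeytingHom α β) (F : PFilter β) : PFilter α :=
  (IsPFilter.of_def (F := f ⁻¹' F) ⟨⊤, by simp⟩
    (fun x hx y hy => ⟨x ⊓ y, by simpa using ⟨hx, hy⟩, inf_le_left, inf_le_right⟩)
    fun hxy hx => mem_of_le (OrderHomClass.mono f hxy) hx).toPFilter

@[simp]
theorem mem_heytingComap {f : HeytingHom α β} {F : PFilter β} {x : α} :
    x ∈ F.heytingComap f ↔ f x ∈ F :=
  Iff.rfl

/-- The filter generated by the image of a filter under a Heyting homomorphism and another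
filter. -/
def heytingMapSup (f : HeytingHom α β) (G : PFilter α) (F : PFilter β) : PFilter β :=
  (IsPFilter.of_def (F := {x | ∃ a ∈ G, f a ⇨ x ∈ F}) ⟨⊤, ⊤, top_mem, by simp⟩
    (by
      rintro x ⟨a, ha, hx⟩ y ⟨b, hb, hy⟩
      refine ⟨x ⊓ y, ⟨a ⊓ b, inf_mem ha hb, ?_⟩, inf_le_left, inf_le_right⟩
      rw [map_inf]
      exact F.inf_himp_inf_mem hx hy)
    (by
      rintro x y hxy ⟨a, ha, hx⟩
      exact ⟨a, ha, F.himp_trans hx (F.himp_mem_of_le hxy)⟩)).toPFilter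

theorem mem_heytingMapSup {f : HeytingHom α β} {G : PFilter α} {F : PFilter β} {x : β} :
    x ∈ heytingMapSup f G F ↔ ∃ a ∈ G, f a ⇨ x ∈ F :=
  Iff.rfl

theorem le_heytingMapSup (f : HeytingHom α β) (G : PFilter α) (F : PFilter β) :
    F ≤ heytingMapSup f G F := fun _ hx => ⟨⊤, top_mem, by simpa using hx⟩

theorem heytingComap_heytingMapSup {f : HeytingHom α β} {G : PFilter α} {F : PFilter β}
    (hFG : F.heytingComap f ≤ G) : (heytingMapSup f G F).heytingComap f = G := by
  refine le_antisymm ?_ fun a ha => ⟨a, ha, F.himp_mem_of_le le_rfl⟩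
  rintro x ⟨a, ha, hx⟩
  refine mem_of_himp_mem (hFG ?_) ha
  rw [mem_heytingComap, map_himp]
  exact hx

/-- The elements of a Heyting algebra are pairwise comparable modulo the filter. -/
def IsHeytingLinear (F : PFilter α) : Prop :=
  ∀ x y : α, x ⇨ y ∈ F ∨ y ⇨ x ∈ F

theorem IsHeytingLinear.mono {F G : PFilter α} (hF : F.IsHeytingLinear) (hFG : F ≤ G) :
    G.IsHeytingLinear :=
  fun x y => (hF x y).imp (fun h => hFG h) fun h => hFG h

theorem IsHeytingLinear.total {F : PFilter α} (hF : F.IsHeytingLinear) (x y : F.HeytingQuotient) :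
    x ≤ y ∨ y ≤ x := by
  obtain ⟨x, rfl⟩ := F.toHeytingQuotient_surjective x
  obtain ⟨y, rfl⟩ := F.toHeytingQuotient_surjective y
  exact hF x y

/-- In a Gödel algebra, disjoint filters and ideals are separated by a filter modulo which all
elements are comparable. -/
theorem exists_isHeytingLinear_of_disjoint (hα : ∀ x y : α, (x ⇨ y) ⊔ (y ⇨ x) = ⊤)
    {F : PFilter α} {I : Ideal α} (hFI : Disjoint (F : Set α) (I : Set α)) :
    ∃ G : PFilter α, G.IsHeytingLinear ∧ F ≤ G ∧ Disjoint (G : Set α) (I : Set α) := by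
  obtain ⟨J, hJ, hIJ, hFJ⟩ := DistribLattice.prime_ideal_of_disjoint_filter_ideal hFI
  refine ⟨hJ.compl_filter.toPFilter, fun x y => ?_, ?_, ?_⟩
  · change x ⇨ y ∉ J ∨ y ⇨ x ∉ J
    by_contra! h
    have := Ideal.sup_mem h.1 h.2
    rw [hα] at this
    exact hJ.toIsProper.top_notMem this
  · exact fun x hx hxJ => Set.disjoint_left.1 hFJ hx hxJ
  · exact Set.disjoint_left.2 fun x hx hxI => hx (hIJ hxI)

/-- If `b` is not in the range of a Heyting homomorphism into a Gödel algebra, then `b` is separated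
by two filters with the same preimage. -/
theorem exists_heytingComap_eq_of_notMem_range (hβ : ∀ x y : β, (x ⇨ y) ⊔ (y ⇨ x) = ⊤)
    (f : HeytingHom α β) {b : β} (hb : b ∉ Set.range f) :
    ∃ F G : PFilter β, F.IsHeytingLinear ∧ G.IsHeytingLinear ∧
      F.heytingComap f = G.heytingComap f ∧ b ∈ F ∧ b ∉ G := by
  let I : Ideal β := (IsIdeal.mk (I := {x | ∃ a, f a ≤ b ∧ x ≤ f a})
    (fun _ _ hyx ⟨a, hab, hxa⟩ => ⟨a, hab, hyx.trans hxa⟩) ⟨⊥, ⊥, by simp⟩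
    (fun x ⟨a, hab, hxa⟩ y ⟨c, hcb, hyc⟩ => ⟨x ⊔ y, ⟨a ⊔ c, by
      rw [map_sup]
      exact ⟨sup_le hab hcb, sup_le_sup hxa hyc⟩⟩, le_sup_left, le_sup_right⟩)).toIdeal
  have hI : Disjoint (principal b : Set β) (I : Set β) :=
    Set.disjoint_left.2 fun x hbx ⟨a, hab, hxa⟩ => hb ⟨a, le_antisymm hab (le_trans hbx hxa)⟩
  obtain ⟨F, hF, hbF, hFI⟩ := exists_isHeytingLinear_of_disjoint hβ hI
  have hFb : Disjoint (heytingMapSup f (F.heytingComap f) ⊥ : Set β) (Ideal.principal b : Set β) := by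
    refine Set.disjoint_left.2 ?_
    rintro x ⟨a, ha, hax⟩ hxb
    have hax : f a ≤ x := by
      rw [← himp_eq_top_iff, ← top_le_iff]
      exact hax
    exact Set.disjoint_left.1 hFI ha ⟨a, hax.trans hxb, le_rfl⟩
  obtain ⟨G, hG, hFG, hGb⟩ := exists_isHeytingLinear_of_disjoint hβ hFb
  refine ⟨heytingMapSup f (G.heytingComap f) F, G, hF.mono (le_heytingMapSup _ _ _), hG,
    heytingComap_heytingMapSup fun a ha => hFG ⟨a, ha, himp_mem_of_le _ le_rfl⟩,
    le_heytingMapSup _ _ _ (hbF le_rfl), fun h => Set.disjoint_left.1 hGb h le_rfl⟩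

end Heyting

end Order.PFilter

namespace HeytingHom

variable {α β γ : Type*} [HeytingAlgebra α] [HeytingAlgebra β] [HeytingAlgebra γ]

open Classical in
/-- The endomorphism of a totally ordered Heyting algebra that collapses a proper upper set to `⊤`
and fixes all other elements. -/
noncomputable def collapse (hα : ∀ x y : α, x ≤ y ∨ y ≤ x) (s : Set α) (hs : IsUpperSet s)
    (hbot : ⊥ ∉ s) : HeytingHom α α :=
  have mono {x y : α} (hxy : x ≤ y) : (if x ∈ s then ⊤ else x) ≤ if y ∈ s then ⊤ else y := by
    by_cases hx : x ∈ s
    · simp [hx, hs hxy hx]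
    · by_cases hy : y ∈ s <;> simp [hx, hy, hxy]
  { toFun x := if x ∈ s then ⊤ else x
    map_sup' x y := by
      rcases hα x y with h | h
      · rw [sup_eq_right.2 h, sup_eq_right.2 (mono h)]
      · rw [sup_eq_left.2 h, sup_eq_left.2 (mono h)]
    map_inf' x y := by
      rcases hα x y with h | h
      · rw [inf_eq_left.2 h, inf_eq_left.2 (mono h)]
      · rw [inf_eq_right.2 h, inf_eq_right.2 (mono h)]
    map_bot' := if_neg hbot
    map_himp' x y := by
      by_cases hxy : x ≤ y
      · rw [himp_eq_top_iff.2 hxy, himp_eq_top_iff.2 (mono hxy), ite_self]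
      · have himp {z : α} (hz : ¬ z ≤ y) : z ⇨ y = y := by
          refine le_antisymm ?_ le_himp
          rcases hα z (z ⇨ y) with h | h
          · exact absurd (le_himp_iff_left.1 h) hz
          · exact (le_inf le_rfl h).trans himp_inf_le
        rw [himp hxy]
        by_cases hy : y ∈ s
        · simp [hy]
        · simp only [hy, if_false]
          refine (himp fun h => hxy (le_trans ?_ h)).symm
          split_ifs <;> simp }

theorem collapse_of_mem {hα : ∀ x y : α, x ≤ y ∨ y ≤ x} {s : Set α} {hs : IsUpperSet s}
    {hbot : ⊥ ∉ s} {x : α} (hx : x ∈ s) : collapse hα s hs hbot x = ⊤ :=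
  if_pos hx

theorem collapse_of_notMem {hα : ∀ x y : α, x ≤ y ∨ y ≤ x} {s : Set α} {hs : IsUpperSet s}
    {hbot : ⊥ ∉ s} {x : α} (hx : x ∉ s) : collapse hα s hs hbot x = x :=
  if_neg hx

/-- A Heyting homomorphism into a totally ordered Heyting algebra is surjective if it is right
cancellable with respect to endomorphisms of its codomain. -/
theorem surjective_of_total (hβ : ∀ x y : β, x ≤ y ∨ y ≤ x) (f : HeytingHom α β)
    (hf : ∀ g₁ g₂ : HeytingHom β β, g₁.comp f = g₂.comp f → g₁ = g₂) : Function.Surjective f := by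
  intro d
  by_contra! hd
  have hbot : ⊥ ∉ Set.Ici d := fun h => hd ⊥ (by rw [map_bot, le_bot_iff.1 h])
  let s : Set β := {y | ∃ a, d ≤ f a ∧ f a ≤ y}
  have hs : IsUpperSet s := fun _ _ hxy ⟨a, hda, hax⟩ => ⟨a, hda, hax.trans hxy⟩
  have hsd : s ⊆ Set.Ici d := fun _ ⟨_, hda, hay⟩ => hda.trans hay
  have key := hf (collapse hβ s hs fun h => hbot (hsd h)) (collapse hβ _ (isUpperSet_Ici d) hbot) <| by
    ext a
    simp only [comp_apply]
    by_cases ha : f a ∈ Set.Ici d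
    · rw [collapse_of_mem (show f a ∈ s from ⟨a, ha, le_rfl⟩), collapse_of_mem ha]
    · rw [collapse_of_notMem (fun h => ha (hsd h)), collapse_of_notMem ha]
  have hds : d ∉ s := fun ⟨a, hda, had⟩ => hd a (le_antisymm had hda)
  have := DFunLike.congr_fun key d
  rw [collapse_of_notMem hds, collapse_of_mem (Set.mem_Ici.2 le_rfl)] at this
  exact hd ⊤ (by rw [map_top, this])

/-- A Heyting homomorphism factors through any surjective one with smaller kernel. -/
theorem exists_comp_eq_of_surjective {f : HeytingHom α β} (hf : Function.Surjective f)
    (g : HeytingHom α γ) (hfg : ∀ a, f a = ⊤ → g a = ⊤) : ∃ e : HeytingHom β γ, e.comp f = g := by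
  have hle {a b : α} (h : f a ≤ f b) : g a ≤ g b := by
    rw [← himp_eq_top_iff, ← map_himp] at h ⊢
    exact hfg _ h
  have heq {a b : α} (h : f a = f b) : g a = g b := le_antisymm (hle h.le) (hle h.ge)
  have hr (b : β) : f (Function.surjInv hf b) = b := Function.surjInv_eq hf b
  have hg (a : α) : g (Function.surjInv hf (f a)) = g a := heq (hr _)
  refine ⟨{ toFun b := g (Function.surjInv hf b), map_sup' := ?_, map_inf' := ?_, map_bot' := ?_,
            map_himp' := ?_ }, ?_⟩
  · intro x y
    rw [← map_sup]
    exact heq (by simp only [map_sup, hr])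
  · intro x y
    rw [← map_inf]
    exact heq (by simp only [map_inf, hr])
  · rw [← map_bot g]
    exact heq (by simp only [map_bot, hr])
  · intro x y
    rw [← map_himp]
    exact heq (by simp only [map_himp, hr])
  · ext a
    exact hg a

end HeytingHom

theorem es_godel_variety
    (K : (A : Type u) → [inst : HeytingAlgebra A] → Prop)
    -- closure under homomorphic images
    (hH : ∀ (A : Type u) [HeytingAlgebra A] (B : Type u) [HeytingAlgebra B],
      K A → (∃ f : HeytingHom A B, Function.Surjective f) → K B)
    -- closure under subalgebras
    (hS : ∀ (A : Type u) [HeytingAlgebra A] (B : Type u) [HeytingAlgebra B],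
      K A → (∃ f : HeytingHom B A, Function.Injective f) → K B)
    -- closure under products
    (hP : ∀ (I : Type u) (A : I → Type u) [∀ i, HeytingAlgebra (A i)],
      (∀ i, K (A i)) → K (∀ i, A i))
    -- every member of `K` satisfies prelinearity, i.e. consists of Gödel algebras
    (hprelin : ∀ (A : Type u) [HeytingAlgebra A], K A →
      ∀ x y : A, (x ⇨ y) ⊔ (y ⇨ x) = ⊤)
    {A B : Type u} [HeytingAlgebra A] [HeytingAlgebra B]
    (hA : K A) (hB : K B) (h : HeytingHom A B)
    -- `h` is a `K`-epimorphism
    (hepi : ∀ (C : Type u) [HeytingAlgebra C], K C →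
      ∀ g₁ g₂ : HeytingHom B C, g₁.comp h = g₂.comp h → g₁ = g₂) :
    Function.Surjective h := by
  have hQ (F : PFilter B) : K F.HeytingQuotient :=
    hH B _ hB ⟨F.toHeytingQuotient, F.toHeytingQuotient_surjective⟩
  have hsurj {F : PFilter B} (hF : F.IsHeytingLinear) :
      Function.Surjective (F.toHeytingQuotient.comp h) :=
    HeytingHom.surjective_of_total hF.total _ fun g₁ g₂ hg =>
      (HeytingHom.cancel_right F.toHeytingQuotient_surjective).1 (hepi _ (hQ F) _ _ hg)
  intro b
  by_contra hb
  obtain ⟨F, G, -, hG, hFG, hbF, hbG⟩ :=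
    PFilter.exists_heytingComap_eq_of_notMem_range (hprelin B hB) h hb
  have hmem (a : A) : h a ∈ F ↔ h a ∈ G := by
    rw [← PFilter.mem_heytingComap, hFG, PFilter.mem_heytingComap]
  obtain ⟨e, he⟩ := HeytingHom.exists_comp_eq_of_surjective (hsurj hG)
    (F.toHeytingQuotient.comp h) fun a => by
      simp only [HeytingHom.comp_apply, PFilter.toHeytingQuotient_eq_top_iff, hmem, imp_self]
  have key := hepi _ (hQ F) (e.comp G.toHeytingQuotient) F.toHeytingQuotient he
  obtain ⟨a, ha⟩ := hsurj hG (G.toHeytingQuotient b)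
  refine hbG (PFilter.toHeytingQuotient_eq_top_iff.1 ?_)
  rw [← ha, HeytingHom.comp_apply, PFilter.toHeytingQuotient_eq_top_iff, ← hmem,
    ← PFilter.toHeytingQuotient_eq_top_iff, ← HeytingHom.comp_apply, ← he,
    HeytingHom.comp_apply, ha, ← HeytingHom.comp_apply, key,
    PFilter.toHeytingQuotient_eq_top_iff]
  exact hbF
end

section
/- In an Esakia space of finite depth, the points of small depth form a closed set: let X be a compact Priestley space in which the lower closure of every clopen set is clopen (an Esakia space), and suppose there is N ∈ ℕ such that every strictly increasing chain in X has at most N elements. Then for every positive integer n, the set of points of X having depth less than n is closed in X. -/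
/-!
STATEMENT 14: In an Esakia space (compact Priestley space where the lower closure
of every clopen set is clopen) of finite depth, for every positive integer `n`
the set of points of depth less than `n` is closed.
-/

universe u

/-- `ChainFrom p k`: there is a strictly increasing chain of `k` elements
starting at `p`. -/
def ChainFrom {X : Type*} [Preorder X] (p : X) (k : ℕ) : Prop :=
  ∃ q : Fin k → X, StrictMono q ∧ ∀ h : 0 < k, q ⟨0, h⟩ = p

/-- `HasDepth p n`: there is a chain `p = p₁ < ⋯ < pₙ` and no chain
`p = q₁ < ⋯ < q_{n+1}` (so `p` has depth `n`; only meaningful for `n ≥ 1`). -/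
def HasDepth {X : Type*} [Preorder X] (p : X) (n : ℕ) : Prop :=
  0 < n ∧ ChainFrom p n ∧ ¬ ChainFrom p (n + 1)

theorem ChainFrom.mono {X : Type*} [Preorder X] {p : X} {j k : ℕ} (hjk : j ≤ k)
    (h : ChainFrom p k) : ChainFrom p j := by
  obtain ⟨q, hq, hp⟩ := h
  exact ⟨q ∘ Fin.castLE hjk, hq.comp (Fin.strictMono_castLE hjk), fun h0 => hp (h0.trans_le hjk)⟩

theorem chainFrom_one {X : Type*} [Preorder X] (p : X) : ChainFrom p 1 :=
  ⟨fun _ => p, Subsingleton.strictMono _, fun _ => rfl⟩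

theorem chainFrom_add_two_iff {X : Type*} [Preorder X] {p : X} {k : ℕ} :
    ChainFrom p (k + 2) ↔ ∃ y, p < y ∧ ChainFrom y (k + 1) := by
  constructor
  · rintro ⟨q, hq, hp⟩
    refine ⟨q 1, ?_, q ∘ Fin.succ, hq.comp Fin.strictMono_succ, fun _ => rfl⟩
    rw [← hp (Nat.succ_pos _)]
    exact hq Fin.zero_lt_one
  · rintro ⟨y, hy, q, hq, hp⟩
    refine ⟨Matrix.vecCons p q, strictMono_vecCons.2 ⟨?_, hq⟩, fun _ => rfl⟩
    exact hy.trans_eq (hp (Nat.succ_pos _)).symm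

theorem exists_hasDepth_lt_iff {X : Type*} [Preorder X] {p : X} {n : ℕ} :
    (∃ m < n, HasDepth p m) ↔ ¬ ChainFrom p n := by
  classical
  constructor
  · rintro ⟨m, hm, -, -, hp⟩ h
    exact hp (h.mono hm)
  · intro h
    have hex : ∃ k, ¬ ChainFrom p k := ⟨n, h⟩
    have hfind := Nat.find_spec hex
    have hle : Nat.find hex ≤ n := Nat.find_min' hex h
    have hgt : 1 < Nat.find hex := by
      by_contra! hle_one
      exact hfind ((chainFrom_one p).mono hle_one)
    refine ⟨Nat.find hex - 1, by omega, by omega, ?_, ?_⟩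
    · exact not_not.1 (Nat.find_min hex (by omega))
    · rwa [Nat.sub_add_cancel hgt.le]

theorem isOpen_setOf_exists_gt_mem {X : Type*} [TopologicalSpace X] [PartialOrder X]
    [PriestleySpace X] [CompactSpace X]
    (hEsakia : ∀ U : Set X, IsClopen U → IsClopen (lowerClosure U : Set X))
    {D : Set X} (hD : IsOpen D) : IsOpen {p : X | ∃ y, p < y ∧ y ∈ D} := by
  rw [isOpen_iff_forall_mem_open]
  rintro p ⟨y, hpy, hy⟩
  obtain ⟨U, hU, -, hyU, hpU⟩ := exists_isClopen_upper_of_not_le hpy.not_ge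
  obtain ⟨V, hV, hyV, hVD⟩ := compact_exists_isClopen_in_isOpen hD hy
  refine ⟨(lowerClosure (V ∩ U) : Set X) \ U, ?_,
    ((hEsakia _ (hV.inter hU)).diff hU).isOpen, ⟨y, ⟨hyV, hyU⟩, hpy.le⟩, hpU⟩
  rintro x ⟨⟨z, ⟨hzV, hzU⟩, hxz⟩, hxU⟩
  exact ⟨z, hxz.lt_of_ne fun h => hxU (h ▸ hzU), hVD hzV⟩

theorem isOpen_setOf_chainFrom {X : Type*} [TopologicalSpace X] [PartialOrder X]
    [PriestleySpace X] [CompactSpace X]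
    (hEsakia : ∀ U : Set X, IsClopen U → IsClopen (lowerClosure U : Set X)) (k : ℕ) :
    IsOpen {p : X | ChainFrom p (k + 1)} := by
  induction k with
  | zero => simp [chainFrom_one]
  | succ k ih =>
    simp only [chainFrom_add_two_iff]
    exact isOpen_setOf_exists_gt_mem hEsakia ih

theorem esakia_small_depth_closed {X : Type u} [TopologicalSpace X]
    [PartialOrder X] [PriestleySpace X] [CompactSpace X]
    -- the lower closure of every clopen set is clopen (Esakia condition)
    (hEsakia : ∀ U : Set X, IsClopen U → IsClopen (lowerClosure U : Set X))
    -- `X` has finite depth: every strictly increasing chain has at most `N` elements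
    (N : ℕ) (hdepth : ∀ (k : ℕ) (q : Fin k → X), StrictMono q → k ≤ N)
    (n : ℕ) (hn : 0 < n) :
    IsClosed {p : X | ∃ m < n, HasDepth p m} := by
  obtain ⟨k, rfl⟩ := Nat.exists_eq_add_of_lt hn
  simp only [exists_hasDepth_lt_iff, zero_add]
  exact (isOpen_setOf_chainFrom hEsakia k).isClosed_compl
end

section
/- Duality criteria for injectivity and surjectivity of Heyting homomorphisms: let h : A → B be a Heyting homomorphism between Heyting algebras, and let Φ be the map sending each prime filter F of B to h⁻¹(F), which is a prime filter of A. Then (i) h is surjective if and only if Φ is injective, and (ii) h is injective if and only if Φ is surjective, i.e., every prime filter of A is of the form h⁻¹(G) for some prime filter G of B. -/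
/-!
STATEMENT 16: Duality criteria for Heyting homomorphisms `h : A → B`: preimages
of prime filters are prime filters, `h` is surjective iff taking preimages is
injective on prime filters of `B`, and `h` is injective iff every prime filter of
`A` is the preimage of a prime filter of `B`.
-/

universe u v

/-- A filter of a lattice: a nonempty upward-closed subset closed under `⊓`. -/
structure IsLatticeFilter {L : Type*} [Lattice L] (F : Set L) : Prop where
  nonempty : F.Nonempty
  mem_of_le : ∀ {x y}, x ∈ F → x ≤ y → y ∈ F
  inf_mem : ∀ {x y}, x ∈ F → y ∈ F → x ⊓ y ∈ F

/-- A prime filter: a proper filter such that `x ⊔ y ∈ F` implies `x ∈ F` or `y ∈ F`. -/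
structure IsPrimeFilter {L : Type*} [Lattice L] (F : Set L) extends
    IsLatticeFilter F : Prop where
  ne_univ : F ≠ Set.univ
  mem_or_mem : ∀ {x y}, x ⊔ y ∈ F → x ∈ F ∨ y ∈ F

/-- Prime filter theorem: a filter disjoint from an ideal extends to a prime filter disjoint
from that ideal. -/
theorem IsLatticeFilter.exists_isPrimeFilter_disjoint {L : Type*} [DistribLattice L]
    {F : Set L} (hF : IsLatticeFilter F) (I : Order.Ideal L) (hFI : Disjoint F (I : Set L)) :
    ∃ G : Set L, IsPrimeFilter G ∧ F ⊆ G ∧ Disjoint G (I : Set L) := by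
  have hpF : Order.IsPFilter F := Order.IsPFilter.of_def hF.nonempty
    (fun x hx y hy => ⟨x ⊓ y, hF.inf_mem hx hy, inf_le_left, inf_le_right⟩)
    (fun hxy hx => hF.mem_of_le hx hxy)
  obtain ⟨J, hJ, hIJ, hFJ⟩ :=
    DistribLattice.prime_ideal_of_disjoint_filter_ideal (F := hpF.toPFilter) (I := I) hFI
  have hFJ' : F ⊆ (J : Set L)ᶜ := Set.subset_compl_iff_disjoint_right.2 hFJ
  refine ⟨(J : Set L)ᶜ, ⟨⟨hF.nonempty.mono hFJ', fun hx hxy hy => hx (J.lower hxy hy), ?_⟩,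
    ?_, ?_⟩, hFJ', Set.disjoint_left.2 fun x hx hxI => hx (hIJ hxI)⟩
  · exact fun hx hy hxy => (hJ.mem_or_mem hxy).elim hx hy
  · obtain ⟨x, hx⟩ := J.nonempty
    exact fun h => (h ▸ Set.mem_univ x : x ∈ (J : Set L)ᶜ) hx
  · intro x y hxy
    by_contra! h
    exact hxy (Order.Ideal.sup_mem (not_not.1 h.1) (not_not.1 h.2))

/-- The ideal generated by the image of a nonempty `⊔`-closed set. -/
def idealOfImage {A B : Type*} [Lattice A] [Lattice B] (h : LatticeHom A B) (S : Set A)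
    (hne : S.Nonempty) (hsup : SupClosed S) : Order.Ideal B where
  carrier := {y | ∃ a ∈ S, y ≤ h a}
  lower' := fun _ _ hyx ⟨a, ha, hx⟩ => ⟨a, ha, hyx.trans hx⟩
  nonempty' := hne.elim fun a ha => ⟨h a, a, ha, le_rfl⟩
  directed' := fun _ ⟨a, ha, hx⟩ _ ⟨b, hb, hy⟩ =>
    ⟨h (a ⊔ b), ⟨a ⊔ b, hsup ha hb, le_rfl⟩,
      hx.trans (OrderHomClass.mono h le_sup_left), hy.trans (OrderHomClass.mono h le_sup_right)⟩

/-- In a distributive lattice, prime filters separate elements. -/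
theorem exists_isPrimeFilter_mem_notMem {L : Type*} [DistribLattice L] {a b : L}
    (hab : ¬ a ≤ b) : ∃ F : Set L, IsPrimeFilter F ∧ a ∈ F ∧ b ∉ F := by
  obtain ⟨F, hF, haF, hbF⟩ := IsLatticeFilter.exists_isPrimeFilter_disjoint
    (F := Set.Ici a) ⟨⟨a, le_rfl⟩, fun hx hxy => le_trans hx hxy, fun hx hy => le_inf hx hy⟩
    (Order.Ideal.principal b) (Set.disjoint_left.2 fun x hax hxb => hab (le_trans hax hxb))
  exact ⟨F, hF, haF le_rfl, fun h => Set.disjoint_left.1 hbF h (le_refl b)⟩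

theorem IsPrimeFilter.preimage {A B : Type*} [Lattice A] [BoundedOrder A] [Lattice B]
    [BoundedOrder B] (h : BoundedLatticeHom A B) {F : Set B} (hF : IsPrimeFilter F) :
    IsPrimeFilter (h ⁻¹' F) where
  nonempty := by
    obtain ⟨x, hx⟩ := hF.nonempty
    exact ⟨⊤, hF.mem_of_le hx (by simp)⟩
  mem_of_le hx hxy := hF.mem_of_le hx (OrderHomClass.mono h hxy)
  inf_mem hx hy := by simpa using hF.inf_mem hx hy
  ne_univ hu := hF.ne_univ <| Set.eq_univ_of_forall fun y =>
    hF.mem_of_le (x := h ⊥) (Set.eq_univ_iff_forall.1 hu ⊥) (by simp)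
  mem_or_mem hxy := hF.mem_or_mem (by simpa using hxy)

/-- The going-up property dual to preservation of `⇨`: a prime filter containing the preimage
of a filter `F` is the preimage of a prime filter containing `F`. -/
theorem IsPrimeFilter.exists_preimage_eq {A B : Type*} [HeytingAlgebra A] [HeytingAlgebra B]
    (h : HeytingHom A B) {F : Set B} (hF : IsLatticeFilter F) {Q : Set A} (hQ : IsPrimeFilter Q)
    (hFQ : h ⁻¹' F ⊆ Q) : ∃ G : Set B, IsPrimeFilter G ∧ F ⊆ G ∧ h ⁻¹' G = Q := by
  obtain ⟨q₀, hq₀⟩ := hQ.nonempty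
  obtain ⟨f₀, hf₀⟩ := hF.nonempty
  have hE : IsLatticeFilter {y | ∃ f ∈ F, ∃ q ∈ Q, f ⊓ h q ≤ y} := by
    refine ⟨⟨_, f₀, hf₀, q₀, hq₀, le_rfl⟩, ?_, ?_⟩
    · rintro x y ⟨f, hf, q, hq, hx⟩ hxy
      exact ⟨f, hf, q, hq, hx.trans hxy⟩
    · rintro x y ⟨f, hf, q, hq, hx⟩ ⟨f', hf', q', hq', hy⟩
      refine ⟨f ⊓ f', hF.inf_mem hf hf', q ⊓ q', hQ.inf_mem hq hq', ?_⟩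
      rw [map_inf, inf_inf_inf_comm]
      exact inf_le_inf hx hy
  obtain ⟨G, hG, hEG, hGI⟩ := hE.exists_isPrimeFilter_disjoint
    (idealOfImage (h : LatticeHom A B) Qᶜ (Set.nonempty_compl.2 hQ.ne_univ)
      fun a ha b hb hab => (hQ.mem_or_mem hab).elim ha hb) (by
    refine Set.disjoint_left.2 ?_
    rintro y ⟨f, hf, q, hq, hy⟩ ⟨a, ha, hya⟩
    have hfa : f ≤ h (q ⇨ a) := by
      rw [map_himp, le_himp_iff]
      exact hy.trans hya
    exact ha (hQ.mem_of_le (hQ.inf_mem (hFQ (hF.mem_of_le hf hfa)) hq) himp_inf_le))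
  refine ⟨G, hG, fun f hf => hEG ⟨f, hf, q₀, hq₀, inf_le_left⟩, Set.Subset.antisymm ?_ ?_⟩
  · intro a ha
    by_contra haQ
    exact Set.disjoint_left.1 hGI ha ⟨a, haQ, le_rfl⟩
  · exact fun q hq => hEG ⟨f₀, hf₀, q, hq, inf_le_right⟩

/-- An element outside the range of a lattice homomorphism is witnessed by two prime filters
with comparable preimages. -/
theorem exists_isPrimeFilter_preimage_subset {A B : Type*} [Lattice A] [BoundedOrder A]
    [DistribLattice B] [BoundedOrder B] (h : BoundedLatticeHom A B) {b : B}
    (hb : b ∉ Set.range h) : ∃ F G : Set B, IsPrimeFilter F ∧ IsPrimeFilter G ∧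
      h ⁻¹' F ⊆ h ⁻¹' G ∧ b ∈ F ∧ b ∉ G := by
  obtain ⟨F, hF, hbF, hFI⟩ := IsLatticeFilter.exists_isPrimeFilter_disjoint
    (F := Set.Ici b) ⟨⟨b, le_rfl⟩, fun hx hxy => le_trans hx hxy, fun hx hy => le_inf hx hy⟩
    (idealOfImage (h : LatticeHom A B) {a | h a ≤ b} ⟨⊥, by simp⟩
      fun x hx y hy => by simpa using And.intro hx hy) (by
    refine Set.disjoint_left.2 ?_
    rintro y hby ⟨a, ha, hya⟩
    exact hb ⟨a, le_antisymm ha (le_trans hby hya)⟩)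
  have hP := hF.preimage h
  obtain ⟨G, hG, hFG, hGb⟩ := IsLatticeFilter.exists_isPrimeFilter_disjoint
    (F := {y | ∃ a ∈ h ⁻¹' F, h a ≤ y}) ⟨hP.nonempty.elim fun a ha => ⟨h a, a, ha, le_rfl⟩,
      fun ⟨a, ha, hx⟩ hxy => ⟨a, ha, hx.trans hxy⟩,
      fun ⟨a, ha, hx⟩ ⟨a', ha', hy⟩ => ⟨a ⊓ a', hP.inf_mem ha ha', by
        rw [map_inf]; exact inf_le_inf hx hy⟩⟩
    (Order.Ideal.principal b) (Set.disjoint_left.2 fun y ⟨a, ha, hay⟩ hyb =>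
      Set.disjoint_left.1 hFI ha ⟨a, hay.trans hyb, le_rfl⟩)
  exact ⟨F, G, hF, hG, fun a ha => hFG ⟨a, ha, le_rfl⟩, hbF le_rfl,
    fun hbG => Set.disjoint_left.1 hGb hbG (le_refl b)⟩

theorem heyting_duality_inj_surj {A : Type u} {B : Type v}
    [HeytingAlgebra A] [HeytingAlgebra B] (h : HeytingHom A B) :
    -- the preimage of a prime filter is a prime filter
    (∀ F : Set B, IsPrimeFilter F → IsPrimeFilter (h ⁻¹' F)) ∧
    -- (i) `h` is surjective iff `Φ : F ↦ h ⁻¹' F` is injective on prime filters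
    (Function.Surjective h ↔
      Set.InjOn (fun F : Set B => h ⁻¹' F) {F : Set B | IsPrimeFilter F}) ∧
    -- (ii) `h` is injective iff `Φ` is surjective onto the prime filters of `A`
    (Function.Injective h ↔
      ∀ F : Set A, IsPrimeFilter F →
        ∃ G : Set B, IsPrimeFilter G ∧ h ⁻¹' G = F) := by
  refine ⟨fun F hF => hF.preimage (h : BoundedLatticeHom A B), ⟨?_, ?_⟩, ⟨?_, ?_⟩⟩
  · exact fun hs F _ G _ hFG => hs.preimage_injective hFG
  · intro hinj b
    by_contra hb
    obtain ⟨F, G, hF, hG, hFG, hbF, hbG⟩ :=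
      exists_isPrimeFilter_preimage_subset (h : BoundedLatticeHom A B) hb
    obtain ⟨G', hG', hFG', hGG'⟩ := IsPrimeFilter.exists_preimage_eq h hF.toIsLatticeFilter
      (hG.preimage (h : BoundedLatticeHom A B)) hFG
    exact hbG (hinj hG' hG hGG' ▸ hFG' hbF)
  · intro hinj Q hQ
    obtain ⟨q, hq⟩ := hQ.nonempty
    obtain ⟨G, hG, -, hGQ⟩ := IsPrimeFilter.exists_preimage_eq h (F := {⊤})
      ⟨Set.singleton_nonempty ⊤, fun hx hxy => top_le_iff.1 (hx ▸ hxy),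
        fun hx hy => by simp_all⟩ hQ
      fun a ha => hQ.mem_of_le hq (hinj (ha.trans (map_top h).symm) ▸ le_top)
    exact ⟨G, hG, hGQ⟩
  · intro hsurj
    have hle : ∀ a b, h a = h b → a ≤ b := by
      intro a b hab
      by_contra hn
      obtain ⟨F, hF, ha, hb⟩ := exists_isPrimeFilter_mem_notMem hn
      obtain ⟨G, -, rfl⟩ := hsurj F hF
      exact hb (show h b ∈ G from hab ▸ ha)
    exact fun a b hab => le_antisymm (hle a b hab) (hle b a hab.symm)
end

section
/- The subalgebra B of the stacked-diamonds Brouwerian algebra A is epic with respect to all well-connected algebras obeying the sibling rule: let C be any Brouwerian algebra such that ⊤ is join-irreducible in C (a ⊔ b = ⊤ implies a = ⊤ or b = ⊤) and C satisfies the sibling rule: for all x, y, z ∈ C, x ≤ y or y ≤ x or x ≤ z or z ≤ x or y = z. If f, g : A → C are Brouwerian homomorphisms with f(x) = g(x) for all x ∈ B, then f = g. -/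
/-!
STATEMENT 17: Let `A` be the stacked-diamonds Brouwerian algebra: its elements
are exactly `⊤` and `tᵢ, bᵢ, cᵢ` (`i ∈ ℕ`), where `t₀ < ⊤`, `bᵢ` and `cᵢ` are
incomparable, `bᵢ ⊔ cᵢ = tᵢ` and `bᵢ ⊓ cᵢ = t_{i+1}` (these conditions determine
`A` up to isomorphism).  Let `B` be the subalgebra with universe
`{bᵢ : i ∈ ℕ} ∪ {⊤}`.  Then for every Brouwerian algebra `C` in which `⊤` is
join-irreducible and which obeys the sibling rule, any two Brouwerian
homomorphisms `f g : A → C` agreeing on `B` are equal.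
-/

universe u v

/-- A Brouwerian homomorphism: a map preserving `⊓`, `⊔`, `⇨` and `⊤`. -/
structure IsBrouwerianHom {α : Type*} {β : Type*} [GeneralizedHeytingAlgebra α]
    [GeneralizedHeytingAlgebra β] (f : α → β) : Prop where
  map_inf : ∀ x y, f (x ⊓ y) = f x ⊓ f y
  map_sup : ∀ x y, f (x ⊔ y) = f x ⊔ f y
  map_himp : ∀ x y, f (x ⇨ y) = f x ⇨ f y
  map_top : f ⊤ = ⊤

namespace IsBrouwerianHom

variable {α : Type*} {β : Type*} [GeneralizedHeytingAlgebra α] [GeneralizedHeytingAlgebra β]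
  {f : α → β}

theorem monotone (hf : IsBrouwerianHom f) : Monotone f := fun x y hxy => by
  rw [← inf_eq_left, ← hf.map_inf, inf_eq_left.2 hxy]

theorem map_eq_top_of_le (hf : IsBrouwerianHom f) {x y : α} (hxy : x ≤ y) (hx : f x = ⊤) :
    f y = ⊤ :=
  top_le_iff.1 (hx ▸ hf.monotone hxy)

theorem map_himp_eq_top_iff (hf : IsBrouwerianHom f) {x y : α} : f (x ⇨ y) = ⊤ ↔ f x ≤ f y := by
  rw [hf.map_himp, himp_eq_top_iff]

end IsBrouwerianHom

/-- If every element is comparable with `x ⊔ y`, then `x ⇨ y = y` unless `x ≤ y`. -/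
theorem himp_eq_right_of_sup_comparable {α : Type*} [GeneralizedHeytingAlgebra α] {x y : α}
    (h : ∀ z, x ⊔ y ≤ z ∨ z ≤ x ⊔ y) (hxy : ¬ x ≤ y) : x ⇨ y = y := by
  refine le_antisymm ?_ le_himp
  rcases h (x ⇨ y) with h | h
  · have hx : x ≤ x ⇨ y := le_sup_left.trans h
    rw [le_himp_iff, inf_idem] at hx
    exact absurd hx hxy
  · calc x ⇨ y = (x ⇨ y) ⊓ (x ⊔ y) := (inf_eq_left.2 h).symm
      _ = ((x ⇨ y) ⊓ x) ⊔ ((x ⇨ y) ⊓ y) := inf_sup_left _ _ _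
      _ ≤ y := sup_le himp_inf_le inf_le_right

theorem stacked_diamonds_subalgebra_epic
    {A : Type u} [GeneralizedHeytingAlgebra A] (t b c : ℕ → A)
    -- every element of `A` is `⊤` or some `tᵢ`, `bᵢ` or `cᵢ`
    (hexh : ∀ x : A, x = ⊤ ∨ (∃ i, x = t i) ∨ (∃ i, x = b i) ∨ (∃ i, x = c i))
    -- `t 0` lies strictly below `⊤`
    (ht0 : t 0 ≠ ⊤)
    -- each diamond: `bᵢ ⊔ cᵢ = tᵢ`, `bᵢ ⊓ cᵢ = t_{i+1}`, `bᵢ` and `cᵢ` incomparable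
    (hsup : ∀ i, b i ⊔ c i = t i)
    (hinf : ∀ i, b i ⊓ c i = t (i + 1))
    (hbc : ∀ i, ¬ b i ≤ c i)
    (hcb : ∀ i, ¬ c i ≤ b i)
    -- `C`: a Brouwerian algebra with `⊤` join-irreducible, obeying the sibling rule
    {C : Type v} [GeneralizedHeytingAlgebra C]
    (hirr : ∀ x y : C, x ⊔ y = ⊤ → x = ⊤ ∨ y = ⊤)
    (hsib : ∀ x y z : C, x ≤ y ∨ y ≤ x ∨ x ≤ z ∨ z ≤ x ∨ y = z)
    (f g : A → C) (hf : IsBrouwerianHom f) (hg : IsBrouwerianHom g)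
    -- `f` and `g` agree on the subalgebra `B = {bᵢ : i ∈ ℕ} ∪ {⊤}`
    (hagree : ∀ x ∈ Set.range b ∪ {(⊤ : A)}, f x = g x) :
    f = g := by
  have agree : ∀ i, f (b i) = g (b i) := fun i => hagree _ (Or.inl ⟨i, rfl⟩)
  have b_le i : b i ≤ t i := hsup i ▸ le_sup_left
  have c_le i : c i ≤ t i := hsup i ▸ le_sup_right
  have le_b i : t (i + 1) ≤ b i := hinf i ▸ inf_le_left
  have le_c i : t (i + 1) ≤ c i := hinf i ▸ inf_le_right
  have anti : Antitone t := antitone_nat_of_succ_le fun i => (le_b i).trans (b_le i)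
  have comparable i x : t i ≤ x ∨ x ≤ t i := by
    rcases hexh x with rfl | ⟨j, rfl⟩ | ⟨j, rfl⟩ | ⟨j, rfl⟩
    · exact Or.inl le_top
    · exact (le_total j i).imp (@anti _ _) (@anti _ _)
    · exact (lt_or_ge j i).imp (fun h => (anti h).trans (le_b j)) fun h => (b_le j).trans (anti h)
    · exact (lt_or_ge j i).imp (fun h => (anti h).trans (le_c j)) fun h => (c_le j).trans (anti h)
  have b_himp i : b i ⇨ c i = c i :=
    himp_eq_right_of_sup_comparable (hsup i ▸ comparable i) (hbc i)
  have c_himp i : c i ⇨ b i = b i :=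
    himp_eq_right_of_sup_comparable (sup_comm (b i) (c i) ▸ hsup i ▸ comparable i) (hcb i)
  have map_c_eq_top {h : A → C} (hh : IsBrouwerianHom h) {i} (hle : h (b i) ≤ h (c i)) :
      h (c i) = ⊤ := b_himp i ▸ hh.map_himp_eq_top_iff.2 hle
  have map_b_eq_top {h : A → C} (hh : IsBrouwerianHom h) {i} (hle : h (c i) ≤ h (b i)) :
      h (b i) = ⊤ := c_himp i ▸ hh.map_himp_eq_top_iff.2 hle
  have map_c_of_ne_top {i} (hb : f (b i) ≠ ⊤) (hc : f (c i) ≠ ⊤) (hc' : g (c i) ≠ ⊤) :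
      f (c i) = g (c i) := by
    rcases hsib (f (b i)) (f (c i)) (g (c i)) with h | h | h | h | h
    · exact absurd (map_c_eq_top hf h) hc
    · exact absurd (map_b_eq_top hf h) hb
    · exact absurd (map_c_eq_top hg (agree i ▸ h)) hc'
    · exact absurd (agree i ▸ map_b_eq_top hg (agree i ▸ h)) hb
    · exact h
  have map_t {i} (hc : f (c i) = g (c i)) : f (t i) = g (t i) := by
    rw [← hsup, hf.map_sup, hg.map_sup, agree, hc]
  have map_t_succ {i} (hb : f (b i) ≠ ⊤) : f (t (i + 1)) = g (t (i + 1)) := by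
    have hb' : g (b i) ≠ ⊤ := agree i ▸ hb
    have hle := (c_le (i + 1)).trans (le_b i)
    exact map_t (map_c_of_ne_top
      (fun h => hb (hf.map_eq_top_of_le ((b_le (i + 1)).trans (le_b i)) h))
      (fun h => hb (hf.map_eq_top_of_le hle h)) fun h => hb' (hg.map_eq_top_of_le hle h))
  have map_c_top_iff {i} (hb : f (b i) ≠ ⊤) : f (c i) = ⊤ ↔ g (c i) = ⊤ := by
    have hinf_iff : f (b i) ⊓ f (c i) = f (b i) ↔ g (b i) ⊓ g (c i) = g (b i) := by
      rw [← hf.map_inf, ← hg.map_inf, hinf, map_t_succ hb, agree]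
    rw [inf_eq_left, inf_eq_left] at hinf_iff
    exact ⟨fun h => map_c_eq_top hg (hinf_iff.1 (h ▸ le_top)),
      fun h => map_c_eq_top hf (hinf_iff.2 (h ▸ le_top))⟩
  have map_c_of_map_b_ne_top {i} (hb : f (b i) ≠ ⊤) : f (c i) = g (c i) := by
    by_cases hc : f (c i) = ⊤
    · rw [hc, (map_c_top_iff hb).1 hc]
    · exact map_c_of_ne_top hb hc fun h => hc ((map_c_top_iff hb).2 h)
  have map_c i : f (c i) = g (c i) := by
    by_cases hb : f (b i) = ⊤
    · by_cases hb' : f (b (i + 1)) = ⊤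
      · have hle := (b_le (i + 1)).trans (le_c i)
        rw [hf.map_eq_top_of_le hle hb', hg.map_eq_top_of_le hle (agree (i + 1) ▸ hb')]
      · have ht := map_t (map_c_of_map_b_ne_top hb')
        rwa [← hinf, hf.map_inf, hg.map_inf, ← agree, hb, top_inf_eq, top_inf_eq] at ht
    · exact map_c_of_map_b_ne_top hb
  funext x
  rcases hexh x with rfl | ⟨i, rfl⟩ | ⟨i, rfl⟩ | ⟨i, rfl⟩
  · rw [hf.map_top, hg.map_top]
  · exact map_t (map_c i)
  · exact agree i
  · exact map_c i
end

section
/- Failure of epimorphism-surjectivity in the variety generated by the stacked-diamonds Brouwerian algebra: the inclusion of B into A is a non-surjective epimorphism in HSP(A); that is, B ≠ A, yet for every Brouwerian algebra C ∈ HSP(A) and all Brouwerian homomorphisms f, g : A → C with f(x) = g(x) for all x ∈ B, one has f = g. -/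
/-!
STATEMENT 18: Failure of epimorphism-surjectivity in the variety generated by the
stacked-diamonds Brouwerian algebra `A`: the inclusion of the subalgebra
`B = {bᵢ : i ∈ ℕ} ∪ {⊤}` into `A` is a non-surjective epimorphism in `HSP(A)`.
Here `A` is characterized (up to isomorphism) by: its elements are exactly `⊤`
and `tᵢ, bᵢ, cᵢ` (`i ∈ ℕ`), with `t₀ < ⊤`, `bᵢ` and `cᵢ` incomparable,
`bᵢ ⊔ cᵢ = tᵢ` and `bᵢ ⊓ cᵢ = t_{i+1}`.
-/

universe u

/-- A bundled Brouwerian algebra (= generalized Heyting algebra). -/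
structure BrouwerianAlgebra : Type (u + 1) where
  carrier : Type u
  [str : GeneralizedHeytingAlgebra carrier]

instance : CoeSort BrouwerianAlgebra.{u} (Type u) :=
  ⟨BrouwerianAlgebra.carrier⟩

instance (D : BrouwerianAlgebra.{u}) : GeneralizedHeytingAlgebra D := D.str

/-- `C` lies in the variety `HSP(A)` generated by the Brouwerian algebra `A`:
`C` is a homomorphic image of a subalgebra of a power of `A`. -/
def BrouwInHSP (A : Type u) [GeneralizedHeytingAlgebra A]
    (C : Type u) [GeneralizedHeytingAlgebra C] : Prop :=
  ∃ (I : Type u) (S : BrouwerianAlgebra.{u}) (f : S → (I → A)) (g : S → C),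
    IsBrouwerianHom f ∧ Function.Injective f ∧
    IsBrouwerianHom g ∧ Function.Surjective g

/-- A set closed under `⊓`, containing `⊤`, upward closed and prime with respect to `⊔`; it need
not be proper. -/
structure IsPrimeFilterSet {C : Type*} [GeneralizedHeytingAlgebra C] (T : Set C) : Prop where
  top_mem : ⊤ ∈ T
  mem_of_le : ∀ {x y}, x ≤ y → x ∈ T → y ∈ T
  inf_mem : ∀ {x y}, x ∈ T → y ∈ T → x ⊓ y ∈ T
  mem_or_mem : ∀ {x y}, x ⊔ y ∈ T → x ∈ T ∨ y ∈ T

namespace IsPrimeFilterSet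

variable {C : Type*} [GeneralizedHeytingAlgebra C] {T : Set C} {x y z : C}

lemma himp_mem_of_le (hT : IsPrimeFilterSet T) (h : x ≤ y) : x ⇨ y ∈ T := by
  rw [himp_eq_top_iff.2 h]
  exact hT.top_mem

lemma himp_mem_of_mem (hT : IsPrimeFilterSet T) (h : y ∈ T) : x ⇨ y ∈ T :=
  hT.mem_of_le le_himp h

lemma mem_of_himp_mem (hT : IsPrimeFilterSet T) (h : x ⇨ y ∈ T) (hx : x ∈ T) : y ∈ T :=
  hT.mem_of_le himp_inf_le (hT.inf_mem h hx)

lemma himp_trans (hT : IsPrimeFilterSet T) (hxy : x ⇨ y ∈ T) (hyz : y ⇨ z ∈ T) : x ⇨ z ∈ T :=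
  hT.mem_of_le (himp_triangle x y z) (hT.inf_mem hxy hyz)

lemma himp_inf_mem (hT : IsPrimeFilterSet T) (hy : x ⇨ y ∈ T) (hz : x ⇨ z ∈ T) :
    x ⇨ y ⊓ z ∈ T := by
  rw [himp_inf_distrib]
  exact hT.inf_mem hy hz

lemma sup_himp_mem (hT : IsPrimeFilterSet T) (hx : x ⇨ z ∈ T) (hy : y ⇨ z ∈ T) :
    x ⊔ y ⇨ z ∈ T := by
  rw [sup_himp_distrib]
  exact hT.inf_mem hx hy

end IsPrimeFilterSet

lemma exists_isPrimeFilterSet_notMem {C : Type*} [GeneralizedHeytingAlgebra C] {x : C}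
    (hx : x ≠ ⊤) : ∃ T : Set C, IsPrimeFilterSet T ∧ x ∉ T := by
  have hdisj : Disjoint ((Order.PFilter.principal (⊤ : C) : Order.PFilter C) : Set C)
      (Order.Ideal.principal x : Set C) := by
    rw [Set.disjoint_left]
    intro y hy hyx
    have h₁ : ⊤ ≤ y := hy
    have h₂ : y ≤ x := hyx
    exact hx (top_le_iff.1 (h₁.trans h₂))
  obtain ⟨J, hJ, hIJ, hFJ⟩ := DistribLattice.prime_ideal_of_disjoint_filter_ideal hdisj
  refine ⟨(J : Set C)ᶜ, ⟨?_, ?_, ?_, ?_⟩, fun h ↦ h (hIJ (le_refl x))⟩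
  · exact fun h ↦ Set.disjoint_left.1 hFJ (le_refl (⊤ : C)) h
  · exact fun hxy hx hy ↦ hx (J.lower hxy hy)
  · exact fun hx hy hxy ↦ (hJ.mem_or_mem hxy).elim hx hy
  · intro y z hyz
    by_contra! h
    exact hyz (J.sup_mem (not_not.1 h.1) (not_not.1 h.2))

/-- An equational form of: an element is incomparable to at most one other element. -/
def UniqueIncomparable (C : Type*) [GeneralizedHeytingAlgebra C] : Prop :=
  ∀ x y z : C, (x ⇨ y) ⊔ (y ⇨ x) ⊔ (z ⇨ x) ⊔ (x ⇨ z) ⊔ (y ⇨ z) = ⊤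

lemma BrouwInHSP.uniqueIncomparable {A C : Type u} [GeneralizedHeytingAlgebra A]
    [GeneralizedHeytingAlgebra C] (h : BrouwInHSP A C) (hA : UniqueIncomparable A) :
    UniqueIncomparable C := by
  obtain ⟨I, S, f, g, hf, hfi, hg, hgs⟩ := h
  intro x y z
  obtain ⟨x, rfl⟩ := hgs x
  obtain ⟨y, rfl⟩ := hgs y
  obtain ⟨z, rfl⟩ := hgs z
  simp only [← hg.map_himp, ← hg.map_sup]
  rw [← hg.map_top]
  congr 1
  apply hfi
  simp only [hf.map_himp, hf.map_sup, hf.map_top]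
  funext i
  exact hA (f x i) (f y i) (f z i)

section StackedDiamonds

variable {A : Type*} [GeneralizedHeytingAlgebra A] {t b c : ℕ → A}

lemma stackedDiamonds_antitone (hsup : ∀ i, b i ⊔ c i = t i)
    (hinf : ∀ i, b i ⊓ c i = t (i + 1)) : Antitone t :=
  antitone_nat_of_succ_le fun i ↦ by
    rw [← hinf, ← hsup]
    exact inf_le_left.trans le_sup_left

lemma stackedDiamonds_trichotomy
    (hexh : ∀ x : A, x = ⊤ ∨ (∃ i, x = t i) ∨ (∃ i, x = b i) ∨ (∃ i, x = c i))
    (hsup : ∀ i, b i ⊔ c i = t i) (hinf : ∀ i, b i ⊓ c i = t (i + 1)) (i : ℕ) (x : A) :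
    t i ≤ x ∨ x ≤ t (i + 1) ∨ x = b i ∨ x = c i := by
  have hanti := stackedDiamonds_antitone hsup hinf
  have key : ∀ j, t (j + 1) ≤ x → x ≤ t j → j ≠ i → t i ≤ x ∨ x ≤ t (i + 1) := by
    intro j h₁ h₂ hji
    rcases lt_or_gt_of_ne hji with h | h
    · exact .inl ((hanti h).trans h₁)
    · exact .inr (h₂.trans (hanti h))
  rcases hexh x with rfl | ⟨j, rfl⟩ | ⟨j, rfl⟩ | ⟨j, rfl⟩
  · exact .inl le_top
  · rcases le_or_gt j i with h | h
    · exact .inl (hanti h)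
    · exact .inr (.inl (hanti h))
  · have := key j (hinf j ▸ inf_le_left) (hsup j ▸ le_sup_left)
    grind
  · have := key j (hinf j ▸ inf_le_right) (hsup j ▸ le_sup_right)
    grind

lemma stackedDiamonds_uniqueIncomparable
    (hexh : ∀ x : A, x = ⊤ ∨ (∃ i, x = t i) ∨ (∃ i, x = b i) ∨ (∃ i, x = c i))
    (hsup : ∀ i, b i ⊔ c i = t i) (hinf : ∀ i, b i ⊓ c i = t (i + 1)) :
    UniqueIncomparable A := by
  have tri := stackedDiamonds_trichotomy hexh hsup hinf
  have hbt : ∀ i, b i ≤ t i := fun i ↦ hsup i ▸ le_sup_left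
  have hct : ∀ i, c i ≤ t i := fun i ↦ hsup i ▸ le_sup_right
  have htb : ∀ i, t (i + 1) ≤ b i := fun i ↦ hinf i ▸ inf_le_left
  have htc : ∀ i, t (i + 1) ≤ c i := fun i ↦ hinf i ▸ inf_le_right
  intro x y z
  suffices h : x ≤ y ∨ y ≤ x ∨ z ≤ x ∨ x ≤ z ∨ y ≤ z by
    rcases h with h | h | h | h | h <;> simp [himp_eq_top_iff.2 h]
  rcases hexh x with rfl | ⟨i, rfl⟩ | ⟨i, rfl⟩ | ⟨i, rfl⟩
  · exact .inr (.inl le_top)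
  · rcases tri i y with h | h | rfl | rfl
    · exact .inl h
    · exact .inr (.inl (h.trans ((htb i).trans (hbt i))))
    · exact .inr (.inl (hbt i))
    · exact .inr (.inl (hct i))
  · have hy := tri i y
    have hz := tri i z
    have := hbt i
    have := htb i
    grind
  · have hy := tri i y
    have hz := tri i z
    have := hct i
    have := htc i
    grind

lemma stackedDiamonds_himp_left
    (hexh : ∀ x : A, x = ⊤ ∨ (∃ i, x = t i) ∨ (∃ i, x = b i) ∨ (∃ i, x = c i))
    (hsup : ∀ i, b i ⊔ c i = t i) (hinf : ∀ i, b i ⊓ c i = t (i + 1))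
    (hcb : ∀ i, ¬ c i ≤ b i) (i : ℕ) : c i ⇨ b i = b i := by
  refine le_antisymm ?_ le_himp
  have hle : (c i ⇨ b i) ⊓ c i ≤ b i := himp_inf_le
  rcases stackedDiamonds_trichotomy hexh hsup hinf i (c i ⇨ b i) with h | h | h | h
  · have hc : c i ≤ c i ⇨ b i := le_trans (hsup i ▸ le_sup_right) h
    rw [inf_eq_right.2 hc] at hle
    exact absurd hle (hcb i)
  · exact h.trans (hinf i ▸ inf_le_left)
  · exact h.le
  · rw [h, inf_idem] at hle
    exact absurd hle (hcb i)

/-- Two sequences `γ`, `δ` that both form stacked diamonds with the same `β` are comparable modulo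
every prime filter. The equations are those satisfied by the images of `b` and `c` under a
Brouwerian homomorphism out of the stacked diamonds. -/
lemma himp_mem_of_notMem {C : Type*} [GeneralizedHeytingAlgebra C] (hC : UniqueIncomparable C)
    {T : Set C} (hT : IsPrimeFilterSet T) {β γ δ : ℕ → C}
    (hβγ : ∀ i, β i ⇨ γ i = γ i) (hγβ : ∀ i, γ i ⇨ β i = β i)
    (hγ : ∀ i, β i ⊓ γ i = β (i + 1) ⊔ γ (i + 1))
    (hβδ : ∀ i, β i ⇨ δ i = δ i) (hδβ : ∀ i, δ i ⇨ β i = β i)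
    (hδ : ∀ i, β i ⊓ δ i = β (i + 1) ⊔ δ (i + 1)) (i : ℕ) : γ i ⇨ δ i ∈ T := by
  have hincomp : ∀ i, β i ∉ T → γ i ∉ T → δ i ∉ T → γ i ⇨ δ i ∈ T := by
    intro i h₁ h₂ h₃
    have h := hT.top_mem
    rw [← hC (β i) (γ i) (δ i), hβγ, hγβ, hδβ, hβδ] at h
    rcases hT.mem_or_mem h with h | h
    · rcases hT.mem_or_mem h with h | h
      · rcases hT.mem_or_mem h with h | h
        · rcases hT.mem_or_mem h with h | h
          · exact absurd h h₂
          · exact absurd h h₁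
        · exact absurd h h₁
      · exact absurd h h₃
    · exact h
  have hsucc : ∀ i, γ (i + 1) ⇨ δ (i + 1) ∈ T → β i ⊓ γ i ⇨ δ i ∈ T := by
    intro i h
    rw [hγ]
    have hle : β (i + 1) ⊔ δ (i + 1) ≤ δ i := hδ i ▸ inf_le_right
    exact hT.sup_himp_mem (hT.himp_mem_of_le (le_sup_left.trans hle))
      (hT.himp_trans h (hT.himp_mem_of_le (le_sup_right.trans hle)))
  have hstep : ∀ i, β i ∉ T → γ i ⇨ δ i ∈ T := by
    intro i h₁
    by_cases h₃ : δ i ∈ T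
    · exact hT.himp_mem_of_mem h₃
    by_cases h₂ : γ i ∈ T
    · have hγle : β (i + 1) ⊔ γ (i + 1) ≤ β i := hγ i ▸ inf_le_left
      have hδle : β (i + 1) ⊔ δ (i + 1) ≤ β i := hδ i ▸ inf_le_left
      have h := hsucc i (hincomp (i + 1)
        (fun h ↦ h₁ (hT.mem_of_le (le_sup_left.trans hγle) h))
        (fun h ↦ h₁ (hT.mem_of_le (le_sup_right.trans hγle) h))
        (fun h ↦ h₁ (hT.mem_of_le (le_sup_right.trans hδle) h)))
      have h' : β i ⇨ δ i ∈ T := hT.himp_trans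
        (hT.himp_inf_mem (hT.himp_mem_of_le le_rfl) (hT.himp_mem_of_mem h₂)) h
      exact absurd (hβδ i ▸ h') h₃
    · exact hincomp i h₁ h₂ h₃
  by_cases h₁ : β i ∈ T
  · by_cases h₃ : δ i ∈ T
    · exact hT.himp_mem_of_mem h₃
    have hle : β (i + 1) ≤ δ i := le_trans le_sup_left (hδ i ▸ inf_le_right)
    exact hT.himp_trans
      (hT.himp_inf_mem (hT.himp_mem_of_mem h₁) (hT.himp_mem_of_le le_rfl))
      (hsucc i (hstep (i + 1) fun h ↦ h₃ (hT.mem_of_le hle h)))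
  · exact hstep i h₁

lemma le_of_stackedDiamonds {C : Type*} [GeneralizedHeytingAlgebra C] (hC : UniqueIncomparable C)
    {β γ δ : ℕ → C}
    (hβγ : ∀ i, β i ⇨ γ i = γ i) (hγβ : ∀ i, γ i ⇨ β i = β i)
    (hγ : ∀ i, β i ⊓ γ i = β (i + 1) ⊔ γ (i + 1))
    (hβδ : ∀ i, β i ⇨ δ i = δ i) (hδβ : ∀ i, δ i ⇨ β i = β i)
    (hδ : ∀ i, β i ⊓ δ i = β (i + 1) ⊔ δ (i + 1)) (i : ℕ) : γ i ≤ δ i := by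
  by_contra h
  obtain ⟨T, hT, hmem⟩ := exists_isPrimeFilterSet_notMem (mt himp_eq_top_iff.1 h)
  exact hmem (himp_mem_of_notMem hC hT hβγ hγβ hγ hβδ hδβ hδ i)

end StackedDiamonds

theorem stacked_diamonds_epi_not_surjective
    {A : Type u} [GeneralizedHeytingAlgebra A] (t b c : ℕ → A)
    -- every element of `A` is `⊤` or some `tᵢ`, `bᵢ` or `cᵢ`
    (hexh : ∀ x : A, x = ⊤ ∨ (∃ i, x = t i) ∨ (∃ i, x = b i) ∨ (∃ i, x = c i))
    -- `t 0` lies strictly below `⊤`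
    (ht0 : t 0 ≠ ⊤)
    -- each diamond: `bᵢ ⊔ cᵢ = tᵢ`, `bᵢ ⊓ cᵢ = t_{i+1}`, `bᵢ` and `cᵢ` incomparable
    (hsup : ∀ i, b i ⊔ c i = t i)
    (hinf : ∀ i, b i ⊓ c i = t (i + 1))
    (hbc : ∀ i, ¬ b i ≤ c i)
    (hcb : ∀ i, ¬ c i ≤ b i) :
    -- the subalgebra `B = {bᵢ : i ∈ ℕ} ∪ {⊤}` is proper ...
    (Set.range b ∪ {(⊤ : A)} ≠ Set.univ) ∧
    -- ... yet its inclusion into `A` is an `HSP(A)`-epimorphism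
    (∀ (C : Type u) [GeneralizedHeytingAlgebra C], BrouwInHSP A C →
      ∀ f g : A → C, IsBrouwerianHom f → IsBrouwerianHom g →
        (∀ x ∈ Set.range b ∪ {(⊤ : A)}, f x = g x) → f = g) := by
  have hcb_himp := stackedDiamonds_himp_left hexh hsup hinf hcb
  have hbc_himp := stackedDiamonds_himp_left (t := t) (b := c) (c := b)
    (fun x ↦ by have := hexh x; tauto) (fun i ↦ by rw [sup_comm, hsup])
    (fun i ↦ by rw [inf_comm, hinf]) hbc
  refine ⟨fun h ↦ ?_, fun C _ hC f g hf hg hfg ↦ ?_⟩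
  · have hc : c 0 ∈ Set.range b ∪ {⊤} := h ▸ Set.mem_univ _
    rcases hc with ⟨j, hj⟩ | hc
    · rcases j with _ | j
      · exact hbc 0 hj.le
      · refine hcb 0 ?_
        calc c 0 = b (j + 1) := hj.symm
          _ ≤ t (j + 1) := hsup (j + 1) ▸ le_sup_left
          _ ≤ t (0 + 1) := stackedDiamonds_antitone hsup hinf (by omega)
          _ ≤ b 0 := hinf 0 ▸ inf_le_left
    · exact hbc 0 (le_top.trans_eq (Set.mem_singleton_iff.1 hc).symm)
  · have hid := hC.uniqueIncomparable (stackedDiamonds_uniqueIncomparable hexh hsup hinf)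
    have hb : ∀ i, f (b i) = g (b i) := fun i ↦ hfg _ (.inl ⟨i, rfl⟩)
    have relations : ∀ k : A → C, IsBrouwerianHom k → (∀ i, k (b i) = g (b i)) →
        (∀ i, g (b i) ⇨ k (c i) = k (c i)) ∧ (∀ i, k (c i) ⇨ g (b i) = g (b i)) ∧
          ∀ i, g (b i) ⊓ k (c i) = g (b (i + 1)) ⊔ k (c (i + 1)) := by
      intro k hk hkb
      refine ⟨fun i ↦ ?_, fun i ↦ ?_, fun i ↦ ?_⟩
      · rw [← hkb, ← hk.map_himp, hbc_himp]
      · rw [← hkb, ← hk.map_himp, hcb_himp]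
      · rw [← hkb, ← hkb, ← hk.map_inf, ← hk.map_sup, hinf, hsup]
    obtain ⟨hf₁, hf₂, hf₃⟩ := relations f hf hb
    obtain ⟨hg₁, hg₂, hg₃⟩ := relations g hg fun _ ↦ rfl
    have hc : ∀ i, f (c i) = g (c i) := fun i ↦ le_antisymm
      (le_of_stackedDiamonds hid hf₁ hf₂ hf₃ hg₁ hg₂ hg₃ i)
      (le_of_stackedDiamonds hid hg₁ hg₂ hg₃ hf₁ hf₂ hf₃ i)
    funext x
    rcases hexh x with rfl | ⟨i, rfl⟩ | ⟨i, rfl⟩ | ⟨i, rfl⟩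
    · rw [hf.map_top, hg.map_top]
    · rw [← hsup, hf.map_sup, hg.map_sup, hb, hc]
    · exact hb i
    · exact hc i
end

section
/- Epimorphism-surjectivity for all varieties of X-algebras: let K be a variety of X-algebras (a class of X-algebras closed under homomorphic images, subalgebras, and pointwise products). Then every K-epimorphism h : A → B with A, B ∈ K (i.e., every X-homomorphism h between members of K such that for every C ∈ K and all X-homomorphisms g₁, g₂ : B → C, g₁ ∘ h = g₂ ∘ h implies g₁ = g₂) is surjective. -/
/-!
STATEMENT 19: Epimorphism-surjectivity for all varieties of X-algebras.  An
X-algebra is a relative Stone algebra (a Brouwerian algebra satisfying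
prelinearity) with a nucleus `◇` and a distinguished element `f` such that
`x ⊔ (x ⇨ f) = ⊤`, `◇(◇x ⇨ x) = ⊤` and `◇x = ⊤ ↔ f ≤ x`.
-/

universe u

/-- An X-algebra. `dia` is the nucleus `◇` and `fel` the distinguished element `f`. -/
class XAlgebra (A : Type u) extends GeneralizedHeytingAlgebra A where
  dia : A → A
  fel : A
  prelinear : ∀ x y : A, (x ⇨ y) ⊔ (y ⇨ x) = ⊤
  le_dia : ∀ x : A, x ≤ dia x
  dia_dia : ∀ x : A, dia (dia x) = dia x
  dia_inf : ∀ x y : A, dia x ⊓ dia y = dia (x ⊓ y)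
  sup_himp_fel : ∀ x : A, x ⊔ (x ⇨ fel) = ⊤
  dia_himp_self : ∀ x : A, dia (dia x ⇨ x) = ⊤
  dia_eq_top_iff : ∀ x : A, dia x = ⊤ ↔ fel ≤ x

/-- An X-homomorphism: a map preserving `⊓`, `⊔`, `⇨`, `⊤`, `◇` and `f`. -/
structure IsXHom {α : Type*} {β : Type*} [XAlgebra α] [XAlgebra β]
    (h : α → β) : Prop where
  map_inf : ∀ x y, h (x ⊓ y) = h x ⊓ h y
  map_sup : ∀ x y, h (x ⊔ y) = h x ⊔ h y
  map_himp : ∀ x y, h (x ⇨ y) = h x ⇨ h y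
  map_top : h ⊤ = ⊤
  map_dia : ∀ x, h (XAlgebra.dia x) = XAlgebra.dia (h x)
  map_fel : h XAlgebra.fel = XAlgebra.fel

/-- Products of X-algebras, with pointwise operations. -/
instance Pi.instXAlgebra {I : Type*} {A : I → Type*} [∀ i, XAlgebra (A i)] :
    XAlgebra (∀ i, A i) where
  dia x := fun i => XAlgebra.dia (x i)
  fel := fun i => XAlgebra.fel
  prelinear x y := by
    funext i
    simpa using XAlgebra.prelinear (x i) (y i)
  le_dia x := fun i => XAlgebra.le_dia (x i)
  dia_dia x := by
    funext i
    exact XAlgebra.dia_dia (x i)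
  dia_inf x y := by
    funext i
    simpa using XAlgebra.dia_inf (x i) (y i)
  sup_himp_fel x := by
    funext i
    simpa using XAlgebra.sup_himp_fel (x i)
  dia_himp_self x := by
    funext i
    simpa using XAlgebra.dia_himp_self (x i)
  dia_eq_top_iff x := by
    constructor
    · intro hx i
      exact (XAlgebra.dia_eq_top_iff (x i)).1 (congrFun hx i)
    · intro hx
      funext i
      exact (XAlgebra.dia_eq_top_iff (x i)).2 (hx i)

section General

variable {α : Type*}

/-- In an X-algebra the nucleus is determined by the distinguished element. -/
theorem XAlgebra.dia_eq_fel_himp [XAlgebra α] (x : α) :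
    XAlgebra.dia x = XAlgebra.fel ⇨ x := by
  have dia_mono {y z : α} (hyz : y ≤ z) : XAlgebra.dia y ≤ XAlgebra.dia z := by
    rw [← inf_eq_left, XAlgebra.dia_inf, inf_eq_left.2 hyz]
  apply le_antisymm
  · have hle := (XAlgebra.dia_eq_top_iff _).1 (XAlgebra.dia_himp_self x)
    rwa [le_himp_iff, inf_comm, ← le_himp_iff] at hle
  · have hfel : XAlgebra.dia (XAlgebra.fel : α) = ⊤ := (XAlgebra.dia_eq_top_iff _).2 le_rfl
    calc XAlgebra.fel ⇨ x ≤ XAlgebra.dia (XAlgebra.fel ⇨ x) := XAlgebra.le_dia _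
      _ = XAlgebra.dia ((XAlgebra.fel ⇨ x) ⊓ XAlgebra.fel) := by
        rw [← XAlgebra.dia_inf, hfel, inf_top_eq]
      _ ≤ XAlgebra.dia x := dia_mono himp_inf_le

/-- A relative Stone algebra with an element `c` satisfying `x ⊔ (x ⇨ c) = ⊤` is an X-algebra
with `f = c` and `◇x = c ⇨ x`. -/
abbrev XAlgebra.ofFel [GeneralizedHeytingAlgebra α] (c : α)
    (prelinear : ∀ x y : α, (x ⇨ y) ⊔ (y ⇨ x) = ⊤) (sup_himp : ∀ x : α, x ⊔ (x ⇨ c) = ⊤) :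
    XAlgebra α where
  dia x := c ⇨ x
  fel := c
  prelinear := prelinear
  le_dia _ := le_himp
  dia_dia x := by rw [himp_himp, inf_idem]
  dia_inf x y := (himp_inf_distrib c x y).symm
  sup_himp_fel := sup_himp
  dia_himp_self x := by
    rw [himp_eq_top_iff, le_himp_iff, inf_comm]
    exact himp_inf_le
  dia_eq_top_iff _ := himp_eq_top_iff

theorem IsXHom.of_map_fel {β : Type*} [XAlgebra α] [XAlgebra β] {g : α → β}
    (map_inf : ∀ x y, g (x ⊓ y) = g x ⊓ g y) (map_sup : ∀ x y, g (x ⊔ y) = g x ⊔ g y)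
    (map_himp : ∀ x y, g (x ⇨ y) = g x ⇨ g y) (map_top : g ⊤ = ⊤)
    (map_fel : g XAlgebra.fel = XAlgebra.fel) : IsXHom g where
  map_inf := map_inf
  map_sup := map_sup
  map_himp := map_himp
  map_top := map_top
  map_dia x := by rw [XAlgebra.dia_eq_fel_himp, XAlgebra.dia_eq_fel_himp, map_himp, map_fel]
  map_fel := map_fel

theorem IsXHom.comp {β γ : Type*} [XAlgebra α] [XAlgebra β] [XAlgebra γ] {g : β → γ} {k : α → β}
    (hg : IsXHom g) (hk : IsXHom k) : IsXHom (g ∘ k) where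
  map_inf x y := by simp only [Function.comp_apply, hk.map_inf, hg.map_inf]
  map_sup x y := by simp only [Function.comp_apply, hk.map_sup, hg.map_sup]
  map_himp x y := by simp only [Function.comp_apply, hk.map_himp, hg.map_himp]
  map_top := by simp only [Function.comp_apply, hk.map_top, hg.map_top]
  map_dia x := by simp only [Function.comp_apply, hk.map_dia, hg.map_dia]
  map_fel := by simp only [Function.comp_apply, hk.map_fel, hg.map_fel]

open Classical in
/-- On a totally ordered X-algebra with `f = ⊤`, collapsing an up-set `Set.Ici c` to `⊤` and
fixing everything else is an X-homomorphism. -/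
theorem isXHom_collapse_Ici [XAlgebra α] (total : ∀ x y : α, x ≤ y ∨ y ≤ x)
    (hfel : (XAlgebra.fel : α) = ⊤) (c : α) :
    IsXHom (fun x : α => if c ≤ x then ⊤ else x) := by
  have himp_of_not_le {x y : α} (hxy : ¬ x ≤ y) : x ⇨ y = y := by
    refine le_antisymm ?_ le_himp
    rcases total x (x ⇨ y) with hle | hle
    · exact absurd (le_himp_iff_left.1 hle) hxy
    · calc x ⇨ y = (x ⇨ y) ⊓ x := (inf_eq_left.2 hle).symm
        _ ≤ y := himp_inf_le
  refine IsXHom.of_map_fel ?_ ?_ ?_ ?_ ?_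
  · intro x y
    rcases total x y with hxy | hxy
    · rw [inf_eq_left.2 hxy]
      by_cases hx : c ≤ x
      · simp [hx, hx.trans hxy]
      · by_cases hy : c ≤ y <;> simp [hx, hy, hxy]
    · rw [inf_eq_right.2 hxy]
      by_cases hy : c ≤ y
      · simp [hy, hy.trans hxy]
      · by_cases hx : c ≤ x <;> simp [hx, hy, hxy]
  · intro x y
    rcases total x y with hxy | hxy
    · rw [sup_eq_right.2 hxy]
      by_cases hy : c ≤ y
      · simp [hy]
      · have hx : ¬ c ≤ x := fun hx => hy (hx.trans hxy)
        simp [hx, hy, hxy]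
    · rw [sup_eq_left.2 hxy]
      by_cases hx : c ≤ x
      · simp [hx]
      · have hy : ¬ c ≤ y := fun hy => hx (hy.trans hxy)
        simp [hx, hy, hxy]
  · intro x y
    by_cases hxy : x ≤ y
    · rw [himp_eq_top_iff.2 hxy]
      by_cases hy : c ≤ y
      · simp [hy]
      · have hx : ¬ c ≤ x := fun hx => hy (hx.trans hxy)
        simp [hx, hy, himp_eq_top_iff.2 hxy]
    · rw [himp_of_not_le hxy]
      by_cases hy : c ≤ y
      · simp [hy]
      · by_cases hx : c ≤ x <;> simp [hx, hy, himp_of_not_le hxy]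
  · simp
  · simp [hfel]

/-- Filters of a Brouwerian algebra, presented by closure under modus ponens. -/
structure ImplicativeFilter (α : Type*) [GeneralizedHeytingAlgebra α] where
  carrier : Set α
  top_mem' : ⊤ ∈ carrier
  mp' : ∀ {x y : α}, x ⇨ y ∈ carrier → x ∈ carrier → y ∈ carrier

namespace ImplicativeFilter

section Basic

variable [GeneralizedHeytingAlgebra α]

instance : SetLike (ImplicativeFilter α) α where
  coe := carrier
  coe_injective F G hFG := by cases F; cases G; congr

variable (F : ImplicativeFilter α) {x y z : α}

theorem top_mem : ⊤ ∈ F := F.top_mem'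

variable {F}

theorem mp (hxy : x ⇨ y ∈ F) (hx : x ∈ F) : y ∈ F := F.mp' hxy hx

theorem himp_mem_of_le (hxy : x ≤ y) : x ⇨ y ∈ F := by
  rw [himp_eq_top_iff.2 hxy]
  exact F.top_mem

theorem mem_of_le (hx : x ∈ F) (hxy : x ≤ y) : y ∈ F := mp (himp_mem_of_le hxy) hx

theorem inf_mem (hx : x ∈ F) (hy : y ∈ F) : x ⊓ y ∈ F :=
  mp (mp (by rw [himp_himp]; exact himp_mem_of_le le_rfl) hx) hy

theorem himp_mem_trans (hxy : x ⇨ y ∈ F) (hyz : y ⇨ z ∈ F) : x ⇨ z ∈ F :=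
  mem_of_le (inf_mem hxy hyz) (himp_triangle x y z)

theorem himp_mem_of_mem (hy : y ∈ F) : x ⇨ y ∈ F := mem_of_le hy le_himp

variable (F)

/-- The filter generated by `F` and `x`. -/
def adjoin (x : α) : ImplicativeFilter α where
  carrier := {z | x ⇨ z ∈ F}
  top_mem' := himp_mem_of_le le_top
  mp' {y z} hyz hy := by
    have hxy : x ⇨ x ⊓ y ∈ F := by rwa [himp_inf_distrib, himp_self, top_inf_eq]
    exact himp_mem_trans hxy (by rwa [← himp_himp])

variable {F}

/-- `F` is prime; the improper filter is allowed. -/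
def IsPrime (F : ImplicativeFilter α) : Prop := ∀ ⦃x y : α⦄, x ⊔ y ∈ F → x ∈ F ∨ y ∈ F

/-- A filter disjoint from a set closed under joins extends to a prime filter disjoint from it. -/
theorem exists_isPrime_of_disjoint (F : ImplicativeFilter α) {S : Set α}
    (hS : ∀ x ∈ S, ∀ y ∈ S, x ⊔ y ∈ S) (hFS : ∀ x ∈ S, x ∉ F) :
    ∃ G : ImplicativeFilter α, (∀ x ∈ F, x ∈ G) ∧ (∀ x ∈ S, x ∉ G) ∧ G.IsPrime := by
  obtain ⟨m, hFm, ⟨G, rfl, hGS⟩, hmax⟩ := zorn_subset_nonempty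
    {C : Set α | ∃ G : ImplicativeFilter α, (G : Set α) = C ∧ ∀ x ∈ S, x ∉ G} (by
      intro c hc hchain ⟨C₀, hC₀⟩
      refine ⟨⋃₀ c, ⟨⟨⋃₀ c, ?_, ?_⟩, rfl, ?_⟩, fun C hC => Set.subset_sUnion_of_mem hC⟩
      · obtain ⟨G, rfl, -⟩ := hc hC₀
        exact ⟨_, hC₀, G.top_mem⟩
      · rintro x y ⟨C, hC, hxy⟩ ⟨C', hC', hx⟩
        rcases hchain.total hC hC' with hle | hle
        · obtain ⟨G, rfl, -⟩ := hc hC'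
          exact ⟨_, hC', G.mp' (hle hxy) hx⟩
        · obtain ⟨G, rfl, -⟩ := hc hC
          exact ⟨_, hC, G.mp' hxy (hle hx)⟩
      · rintro x hxS ⟨C, hC, hx⟩
        obtain ⟨G, rfl, hG⟩ := hc hC
        exact hG x hxS hx) F ⟨F, rfl, hFS⟩
  have exists_himp_mem (x : α) (hx : x ∉ G) : ∃ s ∈ S, x ⇨ s ∈ G := by
    by_contra! hdisj
    refine hx (hmax (y := (G.adjoin x : Set α)) ⟨G.adjoin x, rfl, hdisj⟩ ?_ ?_)
    · exact fun z hz => himp_mem_of_mem (F := G) hz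
    · exact himp_mem_of_le (F := G) le_rfl
  refine ⟨G, hFm, hGS, fun x y hxy => ?_⟩
  by_contra! hnot
  obtain ⟨s, hs, hxs⟩ := exists_himp_mem x hnot.1
  obtain ⟨t, ht, hyt⟩ := exists_himp_mem y hnot.2
  refine hGS _ (hS s hs t ht) (mp ?_ hxy)
  rw [sup_himp_distrib]
  exact inf_mem (himp_mem_trans hxs (himp_mem_of_le le_sup_left))
    (himp_mem_trans hyt (himp_mem_of_le le_sup_right))

variable (F)

/-- Congruence modulo a filter. -/
def setoid : Setoid α where
  r x y := x ⇨ y ∈ F ∧ y ⇨ x ∈ F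
  iseqv :=
    { refl _ := ⟨himp_mem_of_le le_rfl, himp_mem_of_le le_rfl⟩
      symm hxy := hxy.symm
      trans hxy hyz := ⟨himp_mem_trans hxy.1 hyz.1, himp_mem_trans hyz.2 hxy.2⟩ }

/-- The quotient of a Brouwerian algebra by a filter. -/
def Quot : Type _ := Quotient F.setoid

variable {F}

theorem himp_inf_mem (hxy : x ⇨ y ∈ F) (hxz : x ⇨ z ∈ F) : x ⇨ y ⊓ z ∈ F := by
  rw [himp_inf_distrib]
  exact inf_mem hxy hxz

theorem sup_himp_mem (hxz : x ⇨ z ∈ F) (hyz : y ⇨ z ∈ F) : x ⊔ y ⇨ z ∈ F := by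
  rw [sup_himp_distrib]
  exact inf_mem hxz hyz

variable {x' y' : α}

theorem inf_himp_inf_mem (hx : x ⇨ x' ∈ F) (hy : y ⇨ y' ∈ F) : x ⊓ y ⇨ x' ⊓ y' ∈ F :=
  himp_inf_mem (himp_mem_trans (himp_mem_of_le inf_le_left) hx)
    (himp_mem_trans (himp_mem_of_le inf_le_right) hy)

theorem sup_himp_sup_mem (hx : x ⇨ x' ∈ F) (hy : y ⇨ y' ∈ F) : x ⊔ y ⇨ x' ⊔ y' ∈ F :=
  sup_himp_mem (himp_mem_trans hx (himp_mem_of_le le_sup_left))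
    (himp_mem_trans hy (himp_mem_of_le le_sup_right))

theorem himp_himp_himp_mem (hx : x' ⇨ x ∈ F) (hy : y ⇨ y' ∈ F) : (x ⇨ y) ⇨ x' ⇨ y' ∈ F := by
  rw [himp_himp]
  refine himp_mem_trans (himp_mem_trans ?_ (himp_mem_of_le (himp_inf_le (a := x)))) hy
  exact inf_himp_inf_mem (himp_mem_of_le le_rfl) hx

variable (F) in
/-- The canonical projection onto the quotient by a filter. -/
def toQuot (x : α) : F.Quot := Quotient.mk F.setoid x

theorem toQuot_surjective : Function.Surjective F.toQuot := Quotient.mk_surjective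

theorem toQuot_eq_toQuot : F.toQuot x = F.toQuot y ↔ x ⇨ y ∈ F ∧ y ⇨ x ∈ F := Quotient.eq (r := F.setoid)

instance : GeneralizedHeytingAlgebra F.Quot where
  le := Quotient.lift₂ (s₁ := F.setoid) (s₂ := F.setoid) (fun x y => x ⇨ y ∈ F)
    fun _ _ _ _ hx hy => propext
      ⟨fun hle => himp_mem_trans hx.2 (himp_mem_trans hle hy.1),
        fun hle => himp_mem_trans hx.1 (himp_mem_trans hle hy.2)⟩
  inf := Quotient.map₂ (sa := F.setoid) (sb := F.setoid) (sc := F.setoid) (· ⊓ ·)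
    fun _ _ hx _ _ hy => ⟨inf_himp_inf_mem hx.1 hy.1, inf_himp_inf_mem hx.2 hy.2⟩
  sup := Quotient.map₂ (sa := F.setoid) (sb := F.setoid) (sc := F.setoid) (· ⊔ ·)
    fun _ _ hx _ _ hy => ⟨sup_himp_sup_mem hx.1 hy.1, sup_himp_sup_mem hx.2 hy.2⟩
  himp := Quotient.map₂ (sa := F.setoid) (sb := F.setoid) (sc := F.setoid) (· ⇨ ·)
    fun _ _ hx _ _ hy => ⟨himp_himp_himp_mem hx.2 hy.1, himp_himp_himp_mem hx.1 hy.2⟩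
  top := F.toQuot ⊤
  le_refl := by
    rintro ⟨x⟩
    exact himp_mem_of_le (F := F) (le_refl x)
  le_trans := by
    rintro ⟨x⟩ ⟨y⟩ ⟨z⟩ hxy hyz
    exact himp_mem_trans (F := F) hxy hyz
  le_antisymm := by
    rintro ⟨x⟩ ⟨y⟩ hxy hyx
    exact toQuot_eq_toQuot.2 ⟨hxy, hyx⟩
  inf_le_left := by
    rintro ⟨x⟩ ⟨y⟩
    exact himp_mem_of_le (F := F) (inf_le_left : x ⊓ y ≤ x)
  inf_le_right := by
    rintro ⟨x⟩ ⟨y⟩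
    exact himp_mem_of_le (F := F) (inf_le_right : x ⊓ y ≤ y)
  le_inf := by
    rintro ⟨x⟩ ⟨y⟩ ⟨z⟩ hxy hxz
    exact himp_inf_mem (F := F) hxy hxz
  le_sup_left := by
    rintro ⟨x⟩ ⟨y⟩
    exact himp_mem_of_le (F := F) (le_sup_left : x ≤ x ⊔ y)
  le_sup_right := by
    rintro ⟨x⟩ ⟨y⟩
    exact himp_mem_of_le (F := F) (le_sup_right : y ≤ x ⊔ y)
  sup_le := by
    rintro ⟨x⟩ ⟨y⟩ ⟨z⟩ hxz hyz
    exact sup_himp_mem (F := F) hxz hyz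
  le_top := by
    rintro ⟨x⟩
    exact himp_mem_of_le (F := F) (le_top : x ≤ ⊤)
  le_himp_iff := by
    rintro ⟨x⟩ ⟨y⟩ ⟨z⟩
    change x ⇨ y ⇨ z ∈ F ↔ x ⊓ y ⇨ z ∈ F
    rw [himp_himp]

theorem toQuot_le_toQuot : F.toQuot x ≤ F.toQuot y ↔ x ⇨ y ∈ F := Iff.rfl

theorem toQuot_eq_top_iff : F.toQuot x = ⊤ ↔ x ∈ F := by
  rw [← top_le_iff]
  change ⊤ ⇨ x ∈ F ↔ x ∈ F
  rw [top_himp]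

end Basic

section XAlgebra

variable [XAlgebra α] {F G : ImplicativeFilter α}

/-- By prelinearity, every filter containing a prime filter is prime. -/
theorem IsPrime.mono (hF : F.IsPrime) (hFG : ∀ x ∈ F, x ∈ G) : G.IsPrime := by
  intro x y hxy
  rcases hF (x := x ⇨ y) (y := y ⇨ x) (by rw [XAlgebra.prelinear]; exact F.top_mem) with hle | hle
  · exact Or.inr (mp (sup_himp_mem (hFG _ hle) (himp_mem_of_le le_rfl)) hxy)
  · exact Or.inl (mp (sup_himp_mem (himp_mem_of_le le_rfl) (hFG _ hle)) hxy)

instance : XAlgebra F.Quot :=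
  XAlgebra.ofFel (F.toQuot XAlgebra.fel)
    (by
      rintro ⟨x⟩ ⟨y⟩
      exact congrArg F.toQuot (XAlgebra.prelinear x y))
    (by
      rintro ⟨x⟩
      exact congrArg F.toQuot (XAlgebra.sup_himp_fel x))

theorem isXHom_toQuot : IsXHom F.toQuot :=
  IsXHom.of_map_fel (fun _ _ => rfl) (fun _ _ => rfl) (fun _ _ => rfl) rfl rfl

theorem IsPrime.total (hF : F.IsPrime) (p q : F.Quot) : p ≤ q ∨ q ≤ p := by
  obtain ⟨x, rfl⟩ := toQuot_surjective p
  obtain ⟨y, rfl⟩ := toQuot_surjective q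
  exact hF (x := x ⇨ y) (y := y ⇨ x) (by rw [XAlgebra.prelinear]; exact F.top_mem)

end XAlgebra

end ImplicativeFilter

end General

section Epimorphism

open ImplicativeFilter

variable {A B : Type u} [XAlgebra A] [XAlgebra B] {h : A → B} {F G : ImplicativeFilter B}

/-- If `b` is not congruent modulo a prime filter to anything in the range of `h`, then some
quotient of `B` receives two distinct X-homomorphisms that agree on the range of `h`. -/
theorem exists_isXHom_ne_of_forall_toQuot_ne (hhom : IsXHom h) (hF : F.IsPrime) {b : B}
    (hb : ∀ a, F.toQuot b ≠ F.toQuot (h a)) :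
    ∃ (G : ImplicativeFilter B) (g₁ g₂ : B → G.Quot),
      IsXHom g₁ ∧ IsXHom g₂ ∧ g₁ ∘ h = g₂ ∘ h ∧ g₁ ≠ g₂ := by
  classical
  let G : ImplicativeFilter B :=
    { carrier := {x | ∃ a, b ⇨ h a ∈ F ∧ h a ⇨ x ∈ F}
      top_mem' := ⟨⊤, by rw [hhom.map_top]; exact himp_mem_of_le le_top, himp_mem_of_le le_top⟩
      mp' := by
        rintro x y ⟨a, hba, haxy⟩ ⟨a', hba', hax⟩
        refine ⟨a ⊓ a', ?_, ?_⟩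
        · rw [hhom.map_inf]
          exact himp_inf_mem hba hba'
        · rw [hhom.map_inf]
          exact himp_mem_trans (inf_himp_inf_mem haxy hax) (himp_mem_of_le himp_inf_le) }
  have mem_G {x : B} : x ∈ G ↔ ∃ a, b ⇨ h a ∈ F ∧ h a ⇨ x ∈ F := Iff.rfl
  have hFG : ∀ x ∈ F, x ∈ G := fun x hx => ⟨⊤, by
    rw [hhom.map_top]; exact himp_mem_of_le le_top, himp_mem_of_mem hx⟩
  have hG : G.IsPrime := hF.mono hFG
  have hbF : b ∉ F := fun hbF => hb ⊤ (toQuot_eq_toQuot.2 ⟨by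
    rw [hhom.map_top]; exact himp_mem_of_le le_top, himp_mem_of_mem hbF⟩)
  have hfel : XAlgebra.fel ∈ G := by
    have hsup : b ⊔ (b ⇨ XAlgebra.fel) ∈ F := by rw [XAlgebra.sup_himp_fel]; exact F.top_mem
    refine mem_G.2 ⟨XAlgebra.fel, ?_, ?_⟩ <;> rw [hhom.map_fel]
    · exact (hF hsup).resolve_left hbF
    · exact himp_mem_of_le le_rfl
  have hbG : b ∉ G := fun ⟨a, hba, hab⟩ => hb a (toQuot_eq_toQuot.2 ⟨hba, hab⟩)
  refine ⟨G, G.toQuot, _, isXHom_toQuot, (isXHom_collapse_Ici hG.total (toQuot_eq_top_iff.2 hfel)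
    (G.toQuot b)).comp isXHom_toQuot, ?_, ?_⟩
  · funext a
    simp only [Function.comp_apply]
    split_ifs with hle
    · obtain ⟨a', hba', haa'⟩ := mem_G.1 (toQuot_le_toQuot.1 hle)
      have hba : b ⇨ h a ∈ F := by
        rw [← himp_idem]
        exact himp_mem_trans hba' haa'
      exact toQuot_eq_top_iff.2 ⟨a, hba, himp_mem_of_le le_rfl⟩
    · rfl
  · intro heq
    have hb' := congrFun heq b
    simp only [Function.comp_apply, le_refl, if_true, toQuot_eq_top_iff] at hb'
    exact hbG hb'

/-- If two distinct prime filters have the same trace on the range of `h`, and every class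
modulo the first one meets the range of `h`, then the quotient by the second one receives two
distinct X-homomorphisms that agree on the range of `h`. -/
theorem exists_isXHom_ne_of_trace_eq (hhom : IsXHom h) (hGF : G ≠ F)
    (htrace : ∀ a, h a ∈ G ↔ h a ∈ F) (hG : ∀ b, ∃ a, G.toQuot b = G.toQuot (h a)) :
    ∃ g₁ g₂ : B → F.Quot, IsXHom g₁ ∧ IsXHom g₂ ∧ g₁ ∘ h = g₂ ∘ h ∧ g₁ ≠ g₂ := by
  choose r hr using hG
  have toQuot_r {b : B} {a : A} (hba : G.toQuot b = G.toQuot (h a)) : F.toQuot (h (r b)) = F.toQuot (h a) := by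
    have heq := (hr b).symm.trans hba
    rw [toQuot_eq_toQuot, ← hhom.map_himp, ← hhom.map_himp, htrace, htrace] at heq
    rwa [toQuot_eq_toQuot, ← hhom.map_himp, ← hhom.map_himp]
  have hk : IsXHom fun b => F.toQuot (h (r b)) := by
    refine IsXHom.of_map_fel ?_ ?_ ?_ ?_ ?_
    · intro x y
      rw [← isXHom_toQuot.map_inf, ← hhom.map_inf]
      apply toQuot_r
      rw [hhom.map_inf, isXHom_toQuot.map_inf, isXHom_toQuot.map_inf, ← hr, ← hr]
    · intro x y
      rw [← isXHom_toQuot.map_sup, ← hhom.map_sup]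
      apply toQuot_r
      rw [hhom.map_sup, isXHom_toQuot.map_sup, isXHom_toQuot.map_sup, ← hr, ← hr]
    · intro x y
      rw [← isXHom_toQuot.map_himp, ← hhom.map_himp]
      apply toQuot_r
      rw [hhom.map_himp, isXHom_toQuot.map_himp, isXHom_toQuot.map_himp, ← hr, ← hr]
    · rw [← isXHom_toQuot.map_top, ← hhom.map_top]
      exact toQuot_r rfl
    · rw [← isXHom_toQuot.map_fel, ← hhom.map_fel]
      exact toQuot_r rfl
  refine ⟨F.toQuot, _, isXHom_toQuot, hk, funext fun a => (toQuot_r rfl).symm, fun heq => hGF ?_⟩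
  refine SetLike.coe_injective (Set.ext fun x => ?_)
  change x ∈ G ↔ x ∈ F
  rw [← toQuot_eq_top_iff, hr, toQuot_eq_top_iff, htrace, ← toQuot_eq_top_iff, ← toQuot_eq_top_iff,
    congrFun heq x]

/-- If prime filters are determined by their traces on the range of `h`, then each prime filter
is generated by its trace. -/
theorem exists_mem_le_of_trace_injective (hhom : IsXHom h)
    (hinj : ∀ F G : ImplicativeFilter B, F.IsPrime → G.IsPrime →
      (∀ a, h a ∈ F ↔ h a ∈ G) → F = G)
    (hF : F.IsPrime) {e : B} (he : e ∈ F) : ∃ a, h a ∈ F ∧ h a ≤ e := by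
  by_contra! hnot
  let U : ImplicativeFilter B :=
    { carrier := {x | ∃ a, h a ∈ F ∧ h a ≤ x}
      top_mem' := ⟨⊤, by rw [hhom.map_top]; exact F.top_mem, le_top⟩
      mp' := by
        rintro x y ⟨a, ha, haxy⟩ ⟨a', ha', hax⟩
        refine ⟨a ⊓ a', ?_, ?_⟩ <;> rw [hhom.map_inf]
        · exact inf_mem ha ha'
        · exact (inf_le_inf haxy hax).trans himp_inf_le }
  obtain ⟨G, hUG, heG, hG⟩ := U.exists_isPrime_of_disjoint (S := {e})
    (by simp)
    (by rintro x rfl ⟨a, ha, hax⟩; exact hnot a ha hax)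
  let F' : ImplicativeFilter B :=
    { carrier := {x | ∃ a, h a ∈ G ∧ h a ⇨ x ∈ F}
      top_mem' := ⟨⊤, by rw [hhom.map_top]; exact G.top_mem, himp_mem_of_le le_top⟩
      mp' := by
        rintro x y ⟨a, ha, haxy⟩ ⟨a', ha', hax⟩
        refine ⟨a ⊓ a', ?_, ?_⟩ <;> rw [hhom.map_inf]
        · exact inf_mem ha ha'
        · exact himp_mem_trans (inf_himp_inf_mem haxy hax) (himp_mem_of_le himp_inf_le) }
  have hFF' : ∀ x ∈ F, x ∈ F' := fun x hx =>
    ⟨⊤, by rw [hhom.map_top]; exact G.top_mem, himp_mem_of_mem hx⟩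
  have hF'G : F' = G := by
    refine hinj F' G (hF.mono hFF') hG fun a => ⟨?_, fun ha => ⟨a, ha, himp_mem_of_le le_rfl⟩⟩
    rintro ⟨a', ha', hmem⟩
    rw [← hhom.map_himp] at hmem
    have hmemG : h (a' ⇨ a) ∈ G := hUG _ ⟨_, hmem, le_rfl⟩
    rw [hhom.map_himp] at hmemG
    exact mp hmemG ha'
  exact heG e rfl (hF'G ▸ hFF' e he)

/-- If modulo each prime filter every element is congruent to one in the range of `h`, and prime
filters are determined by their traces on that range, then `h` is surjective. -/
theorem surjective_of_trace_injective (hhom : IsXHom h)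
    (hquot : ∀ F : ImplicativeFilter B, F.IsPrime → ∀ b, ∃ a, F.toQuot b = F.toQuot (h a))
    (hinj : ∀ F G : ImplicativeFilter B, F.IsPrime → G.IsPrime →
      (∀ a, h a ∈ F ↔ h a ∈ G) → F = G) :
    Function.Surjective h := by
  intro b
  by_contra hb
  let T : ImplicativeFilter B :=
    { carrier := {⊤}
      top_mem' := rfl
      mp' := by
        rintro x y hxy rfl
        rwa [top_himp] at hxy }
  obtain ⟨F, -, hFS, hF⟩ := T.exists_isPrime_of_disjoint
    (S := {u | ∃ a a', h a = u ∧ h a' = b ⊓ u})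
    (by
      rintro _ ⟨a₁, a₁', rfl, h₁⟩ _ ⟨a₂, a₂', rfl, h₂⟩
      refine ⟨a₁ ⊔ a₂, a₁' ⊔ a₂', hhom.map_sup _ _, ?_⟩
      rw [hhom.map_sup, h₁, h₂, inf_sup_left])
    (by
      rintro _ ⟨a, a', rfl, h'⟩ (htop : h a = ⊤)
      exact hb ⟨a', by rw [h', htop, inf_top_eq]⟩)
  obtain ⟨a, ha⟩ := hquot F hF b
  obtain ⟨hba, hab⟩ := toQuot_eq_toQuot.1 ha
  obtain ⟨u, hu, hle⟩ := exists_mem_le_of_trace_injective hhom hinj hF (inf_mem hba hab)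
  refine hFS (h u) ⟨u, a ⊓ u, rfl, ?_⟩ hu
  rw [hhom.map_inf]
  apply le_antisymm
  · exact le_inf (le_himp_iff'.1 (hle.trans inf_le_right)) inf_le_right
  · exact le_inf (le_himp_iff'.1 (hle.trans inf_le_left)) inf_le_right

end Epimorphism

theorem es_xalgebra_variety
    (K : (A : Type u) → [inst : XAlgebra A] → Prop)
    -- closure under homomorphic images
    (hH : ∀ (A : Type u) [XAlgebra A] (B : Type u) [XAlgebra B],
      K A → (∃ f : A → B, IsXHom f ∧ Function.Surjective f) → K B)
    -- closure under subalgebras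
    (hS : ∀ (A : Type u) [XAlgebra A] (B : Type u) [XAlgebra B],
      K A → (∃ f : B → A, IsXHom f ∧ Function.Injective f) → K B)
    -- closure under products
    (hP : ∀ (I : Type u) (A : I → Type u) [∀ i, XAlgebra (A i)],
      (∀ i, K (A i)) → K (∀ i, A i))
    {A B : Type u} [XAlgebra A] [XAlgebra B]
    (hA : K A) (hB : K B) (h : A → B) (hhom : IsXHom h)
    -- `h` is a `K`-epimorphism
    (hepi : ∀ (C : Type u) [XAlgebra C], K C →
      ∀ g₁ g₂ : B → C, IsXHom g₁ → IsXHom g₂ → g₁ ∘ h = g₂ ∘ h → g₁ = g₂) :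
    Function.Surjective h := by
  have quot_mem (F : ImplicativeFilter B) : K F.Quot :=
    hH B F.Quot hB ⟨F.toQuot, ImplicativeFilter.isXHom_toQuot, ImplicativeFilter.toQuot_surjective⟩
  have toQuot_meets (F : ImplicativeFilter B) (hF : F.IsPrime) (b : B) :
      ∃ a, F.toQuot b = F.toQuot (h a) := by
    by_contra! hb
    obtain ⟨G, g₁, g₂, hg₁, hg₂, hcomp, hne⟩ := exists_isXHom_ne_of_forall_toQuot_ne hhom hF hb
    exact hne (hepi _ (quot_mem G) g₁ g₂ hg₁ hg₂ hcomp)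
  refine surjective_of_trace_injective hhom toQuot_meets fun F G hF _ htrace => ?_
  by_contra hFG
  obtain ⟨g₁, g₂, hg₁, hg₂, hcomp, hne⟩ :=
    exists_isXHom_ne_of_trace_eq hhom hFG htrace (toQuot_meets F hF)
  exact hne (hepi _ (quot_mem G) g₁ g₂ hg₁ hg₂ hcomp)
end
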